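/- CD+ does not prove any of the following sentences: (i) ∀t(TTTt → TTt); (ii) ∀t(TTt → TTTt); (iii) (∀φ ∈ Sent(L_T))(TTφ ↔ TT¬¬φ); (iv) (∀φ,ψ ∈ Sent(L_T))(TT(φ∧ψ) ↔ TTφ ∧ TTψ); (v) (∀φ,ψ ∈ Sent(L_T))(TF(φ∧ψ) ↔ TFφ ∨ TFψ); (vi) (∀φ(v) ∈ Fml¹(L_T))(TT(∀vφ) ↔ T(∀t Tφ(t))); (vii) (∀φ(v) ∈ Fml¹(L_T))(TF(∀vφ) ↔ T(∃t Fφ(t))). -/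

import Mathlib

/- ------------------------------------------------------------------------
Self-contained framework formalizing the setting of Castaldo & Nicolai,
"On Classical Determinate Truth": the languages `L_ℕ ⊆ L_T ⊆ L_D` (with
finitely many function symbols for elementary syntactic operations and a
canonical Gödel numbering), the Fujimoto–Halbach theory `CD⁺`, its variants
`CD⁺↾`, `CD⁺↾cp`, `CD⁺↾sym` with a *defined* determinateness predicate, the
classical closures `CKF`, `CKFcp` of Kripke–Feferman truth, `KF + CONS` and
`CT[KF + CONS]`, the Strong Kleene jump `𝒦` and its fixed-point semantics.

Provability `Proves` is rendered as semantic consequence over arbitrary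
(Type-0) structures of the language, which by Gödel completeness and
downward Löwenheim–Skolem coincides with first-order derivability.  The
arithmetical base of all theories is rendered as the set of all true
arithmetical-syntactic sentences together with the induction schema for the
full language (induction for `T` and `D` as in the paper).
------------------------------------------------------------------------ -/

namespace CDT

attribute [local instance] Classical.propDecidable

/-- Terms of the arithmetical language `L_ℕ`, including function symbols for
the elementary syntactic operations on Gödel codes:
`num` (numeral function), `fneg`/`fand`/`fall`/`feq`/`fT`/`fD` (building codes
of negations, conjunctions, universal quantifications, equations, `T`- and
`D`-ascriptions), `fsub` (formal substitution), `tneg` (term-level composition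
with `fneg`, used for the falsity predicate `F`), `uall`/`uex` (codes of
`∀t Tφ(t)` and `∃t Fφ(t)`), and `evalt` (evaluation `t ↦ t°` of closed terms). -/
inductive Term : Type
  | var   : ℕ → Term
  | zero  : Term
  | succ  : Term → Term
  | add   : Term → Term → Term
  | mul   : Term → Term → Term
  | num   : Term → Term
  | fneg  : Term → Term
  | fand  : Term → Term → Term
  | fall  : Term → Term → Term
  | feq   : Term → Term → Term
  | fT    : Term → Term
  | fD    : Term → Term
  | fsub  : Term → Term → Term → Term
  | tneg  : Term → Term
  | uall  : Term → Term → Term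
  | uex   : Term → Term → Term
  | evalt : Term → Term
  deriving DecidableEq

/-- Formulas of the language `L_D = L_ℕ ∪ {T, D}` (together with the further
Tarskian truth predicate `Tb` = `𝐓` of `CT[KF+CONS]`, and with primitive
predicate symbols for the elementary syntactic guards `Cterm`, `Sent_{L_T}`,
`Sent_{L_D}`, `Fml¹_{L_T}`, `Fml¹_{L_D}`).  `L_T`-formulas are those without
`D` and `Tb`. -/
inductive Fml : Type
  | eq    : Term → Term → Fml
  | T     : Term → Fml
  | D     : Term → Fml
  | Tb    : Term → Fml
  | ct    : Term → Fml
  | sentT : Term → Fml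
  | sentD : Term → Fml
  | fml1T : Term → Term → Fml
  | fml1D : Term → Term → Fml
  | not   : Fml → Fml
  | and   : Fml → Fml → Fml
  | all   : ℕ → Fml → Fml
  deriving DecidableEq

/-- Defined connectives (classical). -/
def Fml.imp (A B : Fml) : Fml := (A.and B.not).not
def Fml.or (A B : Fml) : Fml := (A.not.and B.not).not
def Fml.iff (A B : Fml) : Fml := (A.imp B).and (B.imp A)
def Fml.ex (k : ℕ) (A : Fml) : Fml := (Fml.all k A.not).not

/-- Free variables of a term. -/
def Term.fv : Term → Finset ℕ
  | .var n => {n}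
  | .zero => ∅
  | .succ t => t.fv
  | .add s t => s.fv ∪ t.fv
  | .mul s t => s.fv ∪ t.fv
  | .num t => t.fv
  | .fneg t => t.fv
  | .fand s t => s.fv ∪ t.fv
  | .fall s t => s.fv ∪ t.fv
  | .feq s t => s.fv ∪ t.fv
  | .fT t => t.fv
  | .fD t => t.fv
  | .fsub e s k => e.fv ∪ s.fv ∪ k.fv
  | .tneg t => t.fv
  | .uall s t => s.fv ∪ t.fv
  | .uex s t => s.fv ∪ t.fv
  | .evalt t => t.fv

/-- Free variables of a formula. -/
def Fml.fv : Fml → Finset ℕ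
  | .eq s t => s.fv ∪ t.fv
  | .T t => t.fv
  | .D t => t.fv
  | .Tb t => t.fv
  | .ct t => t.fv
  | .sentT t => t.fv
  | .sentD t => t.fv
  | .fml1T s t => s.fv ∪ t.fv
  | .fml1D s t => s.fv ∪ t.fv
  | .not A => A.fv
  | .and A B => A.fv ∪ B.fv
  | .all k A => A.fv.erase k

/-- Substitution of a term for a variable in a term. -/
def Term.subst (k : ℕ) (s : Term) : Term → Term
  | .var n => if n = k then s else .var n
  | .zero => .zero
  | .succ t => .succ (Term.subst k s t)
  | .add t u => .add (Term.subst k s t) (Term.subst k s u)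
  | .mul t u => .mul (Term.subst k s t) (Term.subst k s u)
  | .num t => .num (Term.subst k s t)
  | .fneg t => .fneg (Term.subst k s t)
  | .fand t u => .fand (Term.subst k s t) (Term.subst k s u)
  | .fall t u => .fall (Term.subst k s t) (Term.subst k s u)
  | .feq t u => .feq (Term.subst k s t) (Term.subst k s u)
  | .fT t => .fT (Term.subst k s t)
  | .fD t => .fD (Term.subst k s t)
  | .fsub e t u => .fsub (Term.subst k s e) (Term.subst k s t) (Term.subst k s u)
  | .tneg t => .tneg (Term.subst k s t)
  | .uall t u => .uall (Term.subst k s t) (Term.subst k s u)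
  | .uex t u => .uex (Term.subst k s t) (Term.subst k s u)
  | .evalt t => .evalt (Term.subst k s t)

/-- Substitution of a (closed) term for a variable in a formula. -/
def Fml.subst (k : ℕ) (s : Term) : Fml → Fml
  | .eq t u => .eq (Term.subst k s t) (Term.subst k s u)
  | .T t => .T (Term.subst k s t)
  | .D t => .D (Term.subst k s t)
  | .Tb t => .Tb (Term.subst k s t)
  | .ct t => .ct (Term.subst k s t)
  | .sentT t => .sentT (Term.subst k s t)
  | .sentD t => .sentD (Term.subst k s t)
  | .fml1T t u => .fml1T (Term.subst k s t) (Term.subst k s u)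
  | .fml1D t u => .fml1D (Term.subst k s t) (Term.subst k s u)
  | .not A => (Fml.subst k s A).not
  | .and A B => (Fml.subst k s A).and (Fml.subst k s B)
  | .all m A => if m = k then .all m A else .all m (Fml.subst k s A)

/-- The formula contains no occurrence of the truth predicate `T`. -/
def Fml.noT : Fml → Prop
  | .T _ => False
  | .not A => A.noT
  | .and A B => A.noT ∧ B.noT
  | .all _ A => A.noT
  | _ => True

/-- The formula contains no occurrence of the determinateness predicate `D`. -/
def Fml.noD : Fml → Prop
  | .D _ => False
  | .not A => A.noD
  | .and A B => A.noD ∧ B.noD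
  | .all _ A => A.noD
  | _ => True

/-- The formula contains no occurrence of the Tarskian predicate `𝐓`. -/
def Fml.noTb : Fml → Prop
  | .Tb _ => False
  | .not A => A.noTb
  | .and A B => A.noTb ∧ B.noTb
  | .all _ A => A.noTb
  | _ => True

/-- `A` is a sentence of `L_T`. -/
def IsSentT (A : Fml) : Prop := A.noD ∧ A.noTb ∧ A.fv = ∅

/-- `A` is a sentence of `L_D`. -/
def IsSentD (A : Fml) : Prop := A.noTb ∧ A.fv = ∅

/-- The numeral of a natural number. -/
def numeral : ℕ → Term
  | 0 => .zero
  | n + 1 => .succ (numeral n)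

/-- The canonical Gödel numbering of terms (injective by construction,
via the Cantor pairing function). -/
def Term.code : Term → ℕ
  | .var n => Nat.pair 1 n
  | .zero => Nat.pair 2 0
  | .succ t => Nat.pair 3 t.code
  | .add s t => Nat.pair 4 (Nat.pair s.code t.code)
  | .mul s t => Nat.pair 5 (Nat.pair s.code t.code)
  | .num t => Nat.pair 6 t.code
  | .fneg t => Nat.pair 7 t.code
  | .fand s t => Nat.pair 8 (Nat.pair s.code t.code)
  | .fall s t => Nat.pair 9 (Nat.pair s.code t.code)
  | .feq s t => Nat.pair 10 (Nat.pair s.code t.code)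
  | .fT t => Nat.pair 11 t.code
  | .fD t => Nat.pair 12 t.code
  | .fsub e s k => Nat.pair 13 (Nat.pair e.code (Nat.pair s.code k.code))
  | .tneg t => Nat.pair 14 t.code
  | .uall s t => Nat.pair 15 (Nat.pair s.code t.code)
  | .uex s t => Nat.pair 16 (Nat.pair s.code t.code)
  | .evalt t => Nat.pair 17 t.code

/-- The canonical Gödel numbering of formulas. -/
def Fml.code : Fml → ℕ
  | .eq s t => Nat.pair 101 (Nat.pair s.code t.code)
  | .T t => Nat.pair 102 t.code
  | .D t => Nat.pair 103 t.code
  | .Tb t => Nat.pair 104 t.code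
  | .ct t => Nat.pair 105 t.code
  | .sentT t => Nat.pair 106 t.code
  | .sentD t => Nat.pair 107 t.code
  | .fml1T s t => Nat.pair 108 (Nat.pair s.code t.code)
  | .fml1D s t => Nat.pair 109 (Nat.pair s.code t.code)
  | .not A => Nat.pair 110 A.code
  | .and A B => Nat.pair 111 (Nat.pair A.code B.code)
  | .all k A => Nat.pair 112 (Nat.pair k A.code)

/-- Partial decoding of terms (the partial inverse of `Term.code`). -/
noncomputable def decT (n : ℕ) : Option Term :=
  if h : ∃ t : Term, t.code = n then some h.choose else none

/-- Partial decoding of formulas. -/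
noncomputable def decF (n : ℕ) : Option Fml :=
  if h : ∃ A : Fml, A.code = n then some h.choose else none

/-! The standard interpretations of the syntactic function symbols. -/

noncomputable def opNum (n : ℕ) : ℕ := (numeral n).code
noncomputable def opFneg (n : ℕ) : ℕ :=
  match decF n with | some A => A.not.code | none => 0
noncomputable def opFand (m n : ℕ) : ℕ :=
  match decF m, decF n with | some A, some B => (A.and B).code | _, _ => 0
noncomputable def opFall (k n : ℕ) : ℕ :=
  match decF n with | some A => (Fml.all k A).code | none => 0
noncomputable def opFeq (m n : ℕ) : ℕ :=
  match decT m, decT n with | some s, some t => (Fml.eq s t).code | _, _ => 0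
noncomputable def opFT (n : ℕ) : ℕ :=
  match decT n with | some t => (Fml.T t).code | none => 0
noncomputable def opFD (n : ℕ) : ℕ :=
  match decT n with | some t => (Fml.D t).code | none => 0
noncomputable def opFsub (e m k : ℕ) : ℕ :=
  match decF e, decT m with | some A, some t => (A.subst k t).code | _, _ => 0
noncomputable def opTneg (n : ℕ) : ℕ :=
  match decT n with | some t => (Term.fneg t).code | none => 0
/-- `opUall k ⌜φ⌝` is the code of the `L_T`-sentence `∀t T(φ(t/v_k))`. -/
noncomputable def opUall (k n : ℕ) : ℕ :=
  (Fml.all 0 ((Fml.ct (.var 0)).imp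
    (Fml.T (.fsub (numeral n) (.var 0) (numeral k))))).code
/-- `opUex k ⌜φ⌝` is the code of the `L_T`-sentence `∃t F(φ(t/v_k))`. -/
noncomputable def opUex (k n : ℕ) : ℕ :=
  ((Fml.all 0 ((Fml.ct (.var 0)).imp
    (Fml.not (Fml.T (.fneg (.fsub (numeral n) (.var 0) (numeral k))))))).not).code

/-- Evaluation of terms, with the evaluation symbol `evalt` sent to `0`
(auxiliary for the standard interpretation `opEval` of `evalt`). -/
noncomputable def Term.val0 (σ : ℕ → ℕ) : Term → ℕ
  | .var n => σ n
  | .zero => 0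
  | .succ t => t.val0 σ + 1
  | .add s t => s.val0 σ + t.val0 σ
  | .mul s t => s.val0 σ * t.val0 σ
  | .num t => opNum (t.val0 σ)
  | .fneg t => opFneg (t.val0 σ)
  | .fand s t => opFand (s.val0 σ) (t.val0 σ)
  | .fall s t => opFall (s.val0 σ) (t.val0 σ)
  | .feq s t => opFeq (s.val0 σ) (t.val0 σ)
  | .fT t => opFT (t.val0 σ)
  | .fD t => opFD (t.val0 σ)
  | .fsub e s k => opFsub (e.val0 σ) (s.val0 σ) (k.val0 σ)
  | .tneg t => opTneg (t.val0 σ)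
  | .uall s t => opUall (s.val0 σ) (t.val0 σ)
  | .uex s t => opUex (s.val0 σ) (t.val0 σ)
  | .evalt _ => 0

/-- The standard interpretation of the evaluation symbol: `⌜t⌝ ↦ t°`. -/
noncomputable def opEval (n : ℕ) : ℕ :=
  match decT n with
  | some t => t.val0 (fun _ => (0 : ℕ))
  | none => 0

/-! Arithmetical (standard) interpretations of the syntactic guards. -/

def isCT (n : ℕ) : Prop := ∃ t : Term, t.code = n ∧ t.fv = ∅
def isSentTC (n : ℕ) : Prop := ∃ A : Fml, A.code = n ∧ IsSentT A
def isSentDC (n : ℕ) : Prop := ∃ A : Fml, A.code = n ∧ IsSentD A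
def isFml1TC (k n : ℕ) : Prop :=
  ∃ A : Fml, A.code = n ∧ A.noD ∧ A.noTb ∧ A.fv ⊆ {k}
def isFml1DC (k n : ℕ) : Prop :=
  ∃ A : Fml, A.code = n ∧ A.noTb ∧ A.fv ⊆ {k}

/-- First-order structures for the language (Type-0 domains suffice for
semantic consequence = provability, by completeness & Löwenheim–Skolem). -/
structure Struc where
  M : Type
  zero : M
  succ : M → M
  add : M → M → M
  mul : M → M → M
  num : M → M
  fneg : M → M
  fand : M → M → M
  fall : M → M → M
  feq : M → M → M
  fT : M → M
  fD : M → M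
  fsub : M → M → M → M
  tneg : M → M
  uall : M → M → M
  uex : M → M → M
  evalt : M → M
  T : M → Prop
  D : M → Prop
  Tb : M → Prop
  ct : M → Prop
  sentT : M → Prop
  sentD : M → Prop
  fml1T : M → M → Prop
  fml1D : M → M → Prop

/-- Evaluation of a term in a structure. -/
def Term.evalS (S : Struc) (σ : ℕ → S.M) : Term → S.M
  | .var n => σ n
  | .zero => S.zero
  | .succ t => S.succ (t.evalS S σ)
  | .add s t => S.add (s.evalS S σ) (t.evalS S σ)
  | .mul s t => S.mul (s.evalS S σ) (t.evalS S σ)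
  | .num t => S.num (t.evalS S σ)
  | .fneg t => S.fneg (t.evalS S σ)
  | .fand s t => S.fand (s.evalS S σ) (t.evalS S σ)
  | .fall s t => S.fall (s.evalS S σ) (t.evalS S σ)
  | .feq s t => S.feq (s.evalS S σ) (t.evalS S σ)
  | .fT t => S.fT (t.evalS S σ)
  | .fD t => S.fD (t.evalS S σ)
  | .fsub e s k => S.fsub (e.evalS S σ) (s.evalS S σ) (k.evalS S σ)
  | .tneg t => S.tneg (t.evalS S σ)
  | .uall s t => S.uall (s.evalS S σ) (t.evalS S σ)
  | .uex s t => S.uex (s.evalS S σ) (t.evalS S σ)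
  | .evalt t => S.evalt (t.evalS S σ)

/-- Tarskian satisfaction of a formula in a structure, under a valuation. -/
def Fml.SatS (S : Struc) : (ℕ → S.M) → Fml → Prop
  | σ, .eq s t => s.evalS S σ = t.evalS S σ
  | σ, .T t => S.T (t.evalS S σ)
  | σ, .D t => S.D (t.evalS S σ)
  | σ, .Tb t => S.Tb (t.evalS S σ)
  | σ, .ct t => S.ct (t.evalS S σ)
  | σ, .sentT t => S.sentT (t.evalS S σ)
  | σ, .sentD t => S.sentD (t.evalS S σ)
  | σ, .fml1T s t => S.fml1T (s.evalS S σ) (t.evalS S σ)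
  | σ, .fml1D s t => S.fml1D (s.evalS S σ) (t.evalS S σ)
  | σ, .not A => ¬ Fml.SatS S σ A
  | σ, .and A B => Fml.SatS S σ A ∧ Fml.SatS S σ B
  | σ, .all k A => ∀ m : S.M, Fml.SatS S (Function.update σ k m) A

/-- The standard model `(ℕ, XT, XD, XTb)`: standard arithmetic and syntax,
with `T`, `D` and `𝐓` interpreted by the given sets of codes. -/
noncomputable def stdStruc (XT XD XTb : Set ℕ) : Struc where
  M := ℕ
  zero := 0
  succ := Nat.succ
  add := (· + ·)
  mul := (· * ·)
  num := opNum
  fneg := opFneg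
  fand := opFand
  fall := opFall
  feq := opFeq
  fT := opFT
  fD := opFD
  fsub := opFsub
  tneg := opTneg
  uall := opUall
  uex := opUex
  evalt := opEval
  T := fun n => n ∈ XT
  D := fun n => n ∈ XD
  Tb := fun n => n ∈ XTb
  ct := isCT
  sentT := isSentTC
  sentD := isSentDC
  fml1T := isFml1TC
  fml1D := isFml1DC

/-- Satisfaction in the standard `L_T`-model `(ℕ, X)`. -/
def SatN (X : Set ℕ) (A : Fml) : Prop :=
  Fml.SatS (stdStruc X ∅ ∅) (fun _ => (0 : ℕ)) A

/-- Satisfaction of all instances (closures) in the standard `L_T`-model. -/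
def SatAll (X : Set ℕ) (A : Fml) : Prop :=
  ∀ σ : ℕ → ℕ, Fml.SatS (stdStruc X ∅ ∅) σ A

/-- `(ℕ, X) ⊨ Th` for an `L_T`-theory. -/
def ModelsN (X : Set ℕ) (Th : Set Fml) : Prop := ∀ A ∈ Th, SatAll X A

/-- Satisfaction in the standard `L_D`-model `(ℕ, XD, XT)` (`D` interpreted
by `XD`, `T` by `XT`). -/
def SatND (XD XT : Set ℕ) (A : Fml) : Prop :=
  Fml.SatS (stdStruc XT XD ∅) (fun _ => (0 : ℕ)) A

/-- `(ℕ, XD, XT) ⊨ Th` for an `L_D`-theory. -/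
def ModelsND (XD XT : Set ℕ) (Th : Set Fml) : Prop :=
  ∀ A ∈ Th, ∀ σ : ℕ → ℕ, Fml.SatS (stdStruc XT XD ∅) σ A

/-- Provability: semantic consequence over arbitrary structures (equivalent
to first-order derivability by Gödel's completeness theorem together with
downward Löwenheim–Skolem). -/
def Proves (Th : Set Fml) (A : Fml) : Prop :=
  ∀ (S : Struc) (σ : ℕ → S.M),
    (∀ B ∈ Th, ∀ τ : ℕ → S.M, Fml.SatS S τ B) → Fml.SatS S σ A

/-- The evaluation `t°` of a closed term in the standard model. -/
noncomputable def tval (t : Term) : ℕ :=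
  Term.evalS (stdStruc ∅ ∅ ∅) (fun _ => (0 : ℕ)) t

/-! ## The base theory: elementary syntax/arithmetic plus full induction -/

/-- The arithmetical-syntactic base: all true `L_ℕ`-sentences. -/
def BaseTh : Set Fml :=
  {A | A.noT ∧ A.noD ∧ A.noTb ∧ A.fv = ∅ ∧
    Fml.SatS (stdStruc ∅ ∅ ∅) (fun _ => (0 : ℕ)) A}

/-- Universal closure of a formula. -/
def Fml.close (A : Fml) : Fml :=
  (A.fv.sort (· ≤ ·)).foldr (fun k B => Fml.all k B) A

/-- Induction axiom for `A` in the variable `v_k` (universally closed;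
the schema is available for the full language, including `T`, `D`, `𝐓`). -/
def indAx (k : ℕ) (A : Fml) : Fml :=
  Fml.close (((A.subst k .zero).and
    (Fml.all k (A.imp (A.subst k (.succ (.var k)))))).imp (Fml.all k A))

/-- The full induction schema. -/
def IndTh : Set Fml := {B | ∃ (k : ℕ) (A : Fml), B = indAx k A}

/-! ## Abbreviations: iterated truth and falsity -/

def v0 : Term := .var 0
def v1 : Term := .var 1
def v2 : Term := .var 2
def v3 : Term := .var 3

/-- `⌜T t⌝` from `⌜t⌝`. -/
def tmT (x : Term) : Term := .fT x
/-- `⌜F t⌝ = ⌜T(¬.t)⌝` from `⌜t⌝` (falsity as truth of the negation). -/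
def tmF (x : Term) : Term := .fT (.tneg x)
/-- `TTφ`, i.e. `T⌜T(num φ)⌝`, for `φ` a sentence code. -/
def sTT (x : Term) : Fml := .T (tmT (.num x))
/-- `TFφ`, i.e. `T⌜F(num φ)⌝`, for `φ` a sentence code. -/
def sTF (x : Term) : Fml := .T (tmF (.num x))
/-- `TT t`, i.e. `T⌜T t⌝`, for `t` a closed-term code. -/
def tTT (x : Term) : Fml := .T (tmT x)
/-- `TF t`, i.e. `T⌜F t⌝`, for `t` a closed-term code. -/
def tTF (x : Term) : Fml := .T (tmF x)

/-! ## The three definitions of determinateness -/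

/-- `D x :↔ TTx ∨ TFx` (for consistent fixed points). -/
def dfCons (x : Term) : Fml := (sTT x).or (sTF x)
/-- `D x :↔ ¬TTx ∨ ¬TFx` (for complete fixed points). -/
def dfComp (x : Term) : Fml := ((sTT x).not).or ((sTF x).not)
/-- `D x :↔ (TTx ∨ TFx) ∧ (¬TTx ∨ ¬TFx)` (for symmetric fixed points). -/
def dfSym (x : Term) : Fml := (dfCons x).and (dfComp x)

/-- `⌜D t⌝` for the primitive determinateness predicate. -/
def dcodePrim (x : Term) : Term := .fD x
/-- `⌜D t⌝` for a defined determinateness predicate `df`: the code of the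
defining formula with `t` substituted for its variable. -/
noncomputable def dcodeOf (df : Term → Fml) (x : Term) : Term :=
  .fsub (numeral (df (.var 0)).code) x (numeral 0)

/-! ## The axioms of `CD⁺` (Fujimoto–Halbach), parametrized by the
determinateness predicate `df`, its code-builder `dc`, and the sentence and
formula guards `gS`, `gF` of the relevant language. -/

def axT1 : Fml :=
  .all 0 (.all 1 (((Fml.ct v0).and (Fml.ct v1)).imp
    (Fml.iff (Fml.T (.feq v0 v1)) (.eq (.evalt v0) (.evalt v1)))))

def axT2p (df : Term → Fml) (dc : Term → Term) : Fml :=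
  .all 0 ((Fml.ct v0).imp (Fml.iff (df (.evalt v0)) (Fml.T (dc v0))))

def axT3 (df : Term → Fml) : Fml :=
  .all 0 ((Fml.ct v0).imp ((df (.evalt v0)).imp
    (Fml.iff (tTT v0) (Fml.T (.evalt v0)))))

def axT4 (gS : Term → Fml) : Fml :=
  .all 0 ((gS v0).imp (Fml.iff (Fml.T (.fneg v0)) (Fml.not (Fml.T v0))))

def axT5 (gS : Term → Fml) : Fml :=
  .all 0 (.all 1 (((gS v0).and (gS v1)).imp
    (Fml.iff (Fml.T (.fand v0 v1)) ((Fml.T v0).and (Fml.T v1)))))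

def axT6 (gF : Term → Term → Fml) : Fml :=
  .all 0 (.all 1 ((gF v0 v1).imp
    (Fml.iff (Fml.T (.fall v0 v1))
      (.all 2 ((Fml.ct v2).imp (Fml.T (.fsub v1 v2 v0)))))))

def axD1 (df : Term → Fml) : Fml :=
  .all 0 (.all 1 (((Fml.ct v0).and (Fml.ct v1)).imp (df (.feq v0 v1))))

def axD2 (df : Term → Fml) : Fml :=
  .all 0 ((Fml.ct v0).imp (Fml.iff (df (tmT v0)) (df (.evalt v0))))

def axD3 (df : Term → Fml) (dc : Term → Term) : Fml :=
  .all 0 ((Fml.ct v0).imp (Fml.iff (df (dc v0)) (df (.evalt v0))))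

def axD4 (df : Term → Fml) (gS : Term → Fml) : Fml :=
  .all 0 ((gS v0).imp (Fml.iff (df (.fneg v0)) (df v0)))

def axD5 (df : Term → Fml) (gS : Term → Fml) : Fml :=
  .all 0 (.all 1 (((gS v0).and (gS v1)).imp
    (Fml.iff (df (.fand v0 v1))
      ((((df v0).and (df v1)).or ((df v0).and (Fml.T (.fneg v0)))).or
        ((df v1).and (Fml.T (.fneg v1)))))))

def axD6 (df : Term → Fml) (gF : Term → Term → Fml) : Fml :=
  .all 0 (.all 1 ((gF v0 v1).imp
    (Fml.iff (df (.fall v0 v1))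
      ((Fml.all 2 ((Fml.ct v2).imp (df (.fsub v1 v2 v0)))).or
        (Fml.ex 2 ((Fml.ct v2).and
          ((df (.fsub v1 v2 v0)).and (Fml.T (.fneg (.fsub v1 v2 v0))))))))))

def axR1 (gF : Term → Term → Fml) : Fml :=
  .all 0 (.all 1 (.all 2 (.all 3 (((gF v0 v1).and ((Fml.ct v2).and (Fml.ct v3))).imp
    ((Fml.eq (.evalt v2) (.evalt v3)).imp
      (Fml.iff (Fml.T (.fsub v1 v2 v0)) (Fml.T (.fsub v1 v3 v0))))))))

def axR2 (df : Term → Fml) (gF : Term → Term → Fml) : Fml :=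
  .all 0 (.all 1 (.all 2 (.all 3 (((gF v0 v1).and ((Fml.ct v2).and (Fml.ct v3))).imp
    ((Fml.eq (.evalt v2) (.evalt v3)).imp
      (Fml.iff (df (.fsub v1 v2 v0)) (df (.fsub v1 v3 v0))))))))

/-- The `CD⁺`-style axiom set over the base theory and full induction. -/
noncomputable def CDAx (df : Term → Fml) (dc : Term → Term)
    (gS : Term → Fml) (gF : Term → Term → Fml) : Set Fml :=
  BaseTh ∪ IndTh ∪
    {axT1, axT2p df dc, axT3 df, axT4 gS, axT5 gS, axT6 gF,
     axD1 df, axD2 df, axD3 df dc, axD4 df gS, axD5 df gS, axD6 df gF,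
     axR1 gF, axR2 df gF}

/-- Fujimoto–Halbach's `CD⁺`, with primitive `D`, in `L_D`. -/
noncomputable def CDplus : Set Fml := CDAx Fml.D dcodePrim Fml.sentD Fml.fml1D

/-- `CD⁺↾`: the axioms of `CD⁺` in `L_T` with `D x` defined as `TTx ∨ TFx`. -/
noncomputable def CDplusRes : Set Fml :=
  CDAx dfCons (dcodeOf dfCons) Fml.sentT Fml.fml1T

/-- `CD⁺↾cp`: the axioms of `CD⁺` with `D x` defined as `¬TTx ∨ ¬TFx`. -/
noncomputable def CDplusResCp : Set Fml :=
  CDAx dfComp (dcodeOf dfComp) Fml.sentT Fml.fml1T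

/-- `CD⁺↾sym`: the axioms of `CD⁺` with
`D x` defined as `(TTx ∨ TFx) ∧ (¬TTx ∨ ¬TFx)`. -/
noncomputable def CDplusResSym : Set Fml :=
  CDAx dfSym (dcodeOf dfSym) Fml.sentT Fml.fml1T

/-! ## The classical closure of Kripke–Feferman truth: `CKF` and `CKFcp` -/

def axT7 : Fml :=
  .all 0 (.all 1 (((Fml.ct v0).and (Fml.ct v1)).imp
    (Fml.iff (sTT (.feq v0 v1)) (.eq (.evalt v0) (.evalt v1)))))

def axT8 : Fml :=
  .all 0 (.all 1 (((Fml.ct v0).and (Fml.ct v1)).imp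
    (Fml.iff (sTF (.feq v0 v1)) (Fml.not (.eq (.evalt v0) (.evalt v1))))))

def axT9 : Fml :=
  .all 0 ((Fml.sentT v0).imp (Fml.iff (sTT v0) (sTT (.fneg (.fneg v0)))))

def axT10 : Fml :=
  .all 0 (.all 1 (((Fml.sentT v0).and (Fml.sentT v1)).imp
    (Fml.iff (sTT (.fand v0 v1)) ((sTT v0).and (sTT v1)))))

def axT11 : Fml :=
  .all 0 (.all 1 (((Fml.sentT v0).and (Fml.sentT v1)).imp
    (Fml.iff (sTF (.fand v0 v1)) ((sTF v0).or (sTF v1)))))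

def axT12 : Fml :=
  .all 0 (.all 1 ((Fml.fml1T v0 v1).imp
    (Fml.iff (sTT (.fall v0 v1)) (Fml.T (.uall v0 v1)))))

def axT13 : Fml :=
  .all 0 (.all 1 ((Fml.fml1T v0 v1).imp
    (Fml.iff (sTF (.fall v0 v1)) (Fml.T (.uex v0 v1)))))

def axT14 : Fml :=
  .all 0 ((Fml.ct v0).imp (Fml.iff (sTT (tmT v0)) (tTT v0)))

def axT15 : Fml :=
  .all 0 ((Fml.ct v0).imp (Fml.iff (sTF (tmT v0)) (tTF v0)))

/-- `TDel : ∀t(TTt → Tt°)`. -/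
def axTDel : Fml :=
  .all 0 ((Fml.ct v0).imp ((tTT v0).imp (Fml.T (.evalt v0))))

/-- `TRep : ∀t(Tt° → TTt)`. -/
def axTRep : Fml :=
  .all 0 ((Fml.ct v0).imp ((Fml.T (.evalt v0)).imp (tTT v0)))

/-- `CKF` without its consistency axiom `TDel`. -/
noncomputable def CKFminus : Set Fml :=
  BaseTh ∪ IndTh ∪
    {axT1, axT4 Fml.sentT, axT5 Fml.sentT, axT6 Fml.fml1T,
     axT7, axT8, axT9, axT10, axT11, axT12, axT13, axT14, axT15,
     axR1 Fml.fml1T}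

/-- The classical closure `CKF` of `KF + CONS`. -/
noncomputable def CKF : Set Fml := insert axTDel CKFminus

/-- The classical closure `CKFcp` of `KF + COMP`. -/
noncomputable def CKFcp : Set Fml := insert axTRep CKFminus

/-! ## `KF + CONS` and `CT[KF + CONS]` -/

def axKF1 : Fml :=
  .all 0 (.all 1 (((Fml.ct v0).and (Fml.ct v1)).imp
    ((Fml.iff (Fml.T (.feq v0 v1)) (.eq (.evalt v0) (.evalt v1))).and
     (Fml.iff (Fml.T (.fneg (.feq v0 v1))) (Fml.not (.eq (.evalt v0) (.evalt v1)))))))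

def axKF2 : Fml :=
  .all 0 ((Fml.ct v0).imp
    ((Fml.iff (Fml.T (tmT v0)) (Fml.T (.evalt v0))).and
     (Fml.iff (Fml.T (.fneg (tmT v0)))
       ((Fml.T (.fneg (.evalt v0))).or (Fml.not (Fml.sentT (.evalt v0)))))))

def axKF3 : Fml :=
  .all 0 ((Fml.sentT v0).imp
    (Fml.iff (Fml.T (.fneg (.fneg v0))) (Fml.T v0)))

def axKF4 : Fml :=
  .all 0 (.all 1 (((Fml.sentT v0).and (Fml.sentT v1)).imp
    ((Fml.iff (Fml.T (.fand v0 v1)) ((Fml.T v0).and (Fml.T v1))).and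
     (Fml.iff (Fml.T (.fneg (.fand v0 v1)))
       ((Fml.T (.fneg v0)).or (Fml.T (.fneg v1)))))))

def axKF5 : Fml :=
  .all 0 (.all 1 ((Fml.fml1T v0 v1).imp
    ((Fml.iff (Fml.T (.fall v0 v1))
        (.all 2 ((Fml.ct v2).imp (Fml.T (.fsub v1 v2 v0))))).and
     (Fml.iff (Fml.T (.fneg (.fall v0 (.fneg v1))))
        (Fml.ex 2 ((Fml.ct v2).and (Fml.T (.fsub v1 v2 v0))))))))

/-- `CONS : ∀φ(Fφ → ¬Tφ)`. -/
def axCons : Fml :=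
  .all 0 ((Fml.sentT v0).imp ((Fml.T (.fneg v0)).imp (Fml.not (Fml.T v0))))

/-- `COMP : ∀φ(¬Tφ → Fφ)`. -/
def axComp : Fml :=
  .all 0 ((Fml.sentT v0).imp ((Fml.not (Fml.T v0)).imp (Fml.T (.fneg v0))))

noncomputable def KFCONS : Set Fml :=
  BaseTh ∪ IndTh ∪ {axKF1, axKF2, axKF3, axKF4, axKF5, axCons}

def axTb1 : Fml :=
  .all 0 (.all 1 (((Fml.ct v0).and (Fml.ct v1)).imp
    (Fml.iff (Fml.Tb (.feq v0 v1)) (.eq (.evalt v0) (.evalt v1)))))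

def axTb1b : Fml :=
  .all 0 ((Fml.ct v0).imp (Fml.iff (Fml.Tb (tmT v0)) (Fml.T (.evalt v0))))

def axTb2 : Fml :=
  .all 0 ((Fml.sentT v0).imp
    (Fml.iff (Fml.Tb (.fneg v0)) (Fml.not (Fml.Tb v0))))

def axTb3 : Fml :=
  .all 0 (.all 1 (((Fml.sentT v0).and (Fml.sentT v1)).imp
    (Fml.iff (Fml.Tb (.fand v0 v1)) ((Fml.Tb v0).and (Fml.Tb v1)))))

def axTb4 : Fml :=
  .all 0 (.all 1 ((Fml.fml1T v0 v1).imp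
    (Fml.iff (Fml.Tb (.fall v0 v1))
      (.all 2 ((Fml.ct v2).imp (Fml.Tb (.fsub v1 v2 v0)))))))

/-- `CT[KF + CONS]`: `KF + CONS` with a Tarskian truth predicate `𝐓` on top. -/
noncomputable def CTKFC : Set Fml :=
  KFCONS ∪ {axTb1, axTb1b, axTb2, axTb3, axTb4}

/-! ## The Strong Kleene jump and its fixed points -/

/-- The Strong Kleene jump `𝒦` on sets of codes of `L_T`-sentences. -/
noncomputable def K (X : Set ℕ) : Set ℕ :=
  {n | isSentTC n ∧ (
    (∃ s t : Term, s.fv = ∅ ∧ t.fv = ∅ ∧ n = (Fml.eq s t).code ∧ tval s = tval t) ∨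
    (∃ s t : Term, s.fv = ∅ ∧ t.fv = ∅ ∧ n = (Fml.eq s t).not.code ∧ tval s ≠ tval t) ∨
    (∃ t : Term, t.fv = ∅ ∧ n = (Fml.T t).code ∧ tval t ∈ X) ∨
    (∃ t : Term, t.fv = ∅ ∧ n = (Fml.T t).not.code ∧
      (opFneg (tval t) ∈ X ∨ ¬ isSentTC (tval t))) ∨
    (∃ t : Term, t.fv = ∅ ∧ n = (Fml.ct t).code ∧ isCT (tval t)) ∨
    (∃ t : Term, t.fv = ∅ ∧ n = (Fml.ct t).not.code ∧ ¬ isCT (tval t)) ∨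
    (∃ t : Term, t.fv = ∅ ∧ n = (Fml.sentT t).code ∧ isSentTC (tval t)) ∨
    (∃ t : Term, t.fv = ∅ ∧ n = (Fml.sentT t).not.code ∧ ¬ isSentTC (tval t)) ∨
    (∃ t : Term, t.fv = ∅ ∧ n = (Fml.sentD t).code ∧ isSentDC (tval t)) ∨
    (∃ t : Term, t.fv = ∅ ∧ n = (Fml.sentD t).not.code ∧ ¬ isSentDC (tval t)) ∨
    (∃ s t : Term, s.fv = ∅ ∧ t.fv = ∅ ∧ n = (Fml.fml1T s t).code ∧
      isFml1TC (tval s) (tval t)) ∨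
    (∃ s t : Term, s.fv = ∅ ∧ t.fv = ∅ ∧ n = (Fml.fml1T s t).not.code ∧
      ¬ isFml1TC (tval s) (tval t)) ∨
    (∃ s t : Term, s.fv = ∅ ∧ t.fv = ∅ ∧ n = (Fml.fml1D s t).code ∧
      isFml1DC (tval s) (tval t)) ∨
    (∃ s t : Term, s.fv = ∅ ∧ t.fv = ∅ ∧ n = (Fml.fml1D s t).not.code ∧
      ¬ isFml1DC (tval s) (tval t)) ∨
    (∃ A : Fml, n = A.not.not.code ∧ A.code ∈ X) ∨
    (∃ A B : Fml, n = (A.and B).code ∧ A.code ∈ X ∧ B.code ∈ X) ∨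
    (∃ A B : Fml, n = (A.and B).not.code ∧ (A.not.code ∈ X ∨ B.not.code ∈ X)) ∨
    (∃ (k : ℕ) (A : Fml), n = (Fml.all k A).code ∧
      ∀ t : Term, t.fv = ∅ → (A.subst k t).code ∈ X) ∨
    (∃ (k : ℕ) (A : Fml), n = (Fml.all k A).not.code ∧
      ∃ t : Term, t.fv = ∅ ∧ (A.subst k t).not.code ∈ X))}

/-- `X` is a fixed point of the Strong Kleene jump. -/
noncomputable def IsFP (X : Set ℕ) : Prop := K X = X

/-- `X` is consistent: no sentence is in `X` together with its negation. -/
def ConsistentS (X : Set ℕ) : Prop :=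
  ∀ A : Fml, ¬ (A.code ∈ X ∧ A.not.code ∈ X)

/-- `X` is complete: every `L_T`-sentence or its negation is in `X`. -/
def CompleteS (X : Set ℕ) : Prop :=
  ∀ A : Fml, IsSentT A → (A.code ∈ X ∨ A.not.code ∈ X)

/-- `𝕋_X`: the set of (codes of) `L_T`-sentences true in `(ℕ, X)` — the
classical closure of `X`. -/
def TrueSet (X : Set ℕ) : Set ℕ :=
  {n | ∃ A : Fml, A.code = n ∧ IsSentT A ∧ SatN X A}

/-- The inner extension `S^𝒮 = {A : (ℕ, S) ⊨ T⌜T⌜A⌝⌝}`. -/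
def SI (S : Set ℕ) : Set ℕ :=
  {n | ∃ A : Fml, A.code = n ∧ IsSentT A ∧
    SatN S (Fml.T (numeral ((Fml.T (numeral A.code)).code)))}

/-! ## The Fujimoto–Halbach model construction for `CD⁺` -/

/-- The positive inductive operator `Γ_Y(X)` associated with the
(right-to-left directions of) the determinateness axioms `D1`–`D6`. -/
noncomputable def Gamma (Y X : Set ℕ) : Set ℕ :=
  {n | isSentDC n ∧ (
    (∃ s t : Term, s.fv = ∅ ∧ t.fv = ∅ ∧ n = (Fml.eq s t).code) ∨
    (∃ t : Term, t.fv = ∅ ∧ n = (Fml.T t).code ∧ tval t ∈ X) ∨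
    (∃ t : Term, t.fv = ∅ ∧ n = (Fml.D t).code ∧ tval t ∈ X) ∨
    (∃ A : Fml, n = A.not.code ∧ A.code ∈ X) ∨
    (∃ A B : Fml, n = (A.and B).code ∧
      ((A.code ∈ X ∧ B.code ∈ X) ∨ (A.code ∈ X ∧ A.not.code ∈ Y) ∨
        (B.code ∈ X ∧ B.not.code ∈ Y))) ∨
    (∃ (k : ℕ) (A : Fml), n = (Fml.all k A).code ∧
      ((∀ t : Term, t.fv = ∅ → (A.subst k t).code ∈ X) ∨
        (∃ t : Term, t.fv = ∅ ∧ (A.subst k t).code ∈ X ∧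
          (A.subst k t).not.code ∈ Y))))}

/-- The set of codes of `L_D`-sentences true in `(ℕ, XD, XT)`. -/
def TrueSetD (XD XT : Set ℕ) : Set ℕ :=
  {n | ∃ A : Fml, A.code = n ∧ IsSentD A ∧ SatND XD XT A}

/-- The Fujimoto–Halbach simultaneous transfinite recursion
`(D_α, T_α)` (Def. on p. `semcdp` of the paper). -/
noncomputable def FH : Ordinal.{0} → Set ℕ × Set ℕ := fun α =>
  Ordinal.limitRecOn α (∅, ∅)
    (fun _ p => (Gamma p.2 p.1, TrueSetD p.1 p.2))
    (fun β _ ih =>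
      ({n | ∃ (γ : Ordinal) (h : γ < β), n ∈ (ih γ h).1},
       {n | ∃ (γ : Ordinal) (h : γ < β), n ∈ (ih γ h).1 ∩ (ih γ h).2}))

/-- `D∞ = D_{ω₁}`. -/
noncomputable def DInf : Set ℕ := (FH (Cardinal.aleph 1).ord).1
/-- `T∞ = T_{ω₁}`. -/
noncomputable def TInf : Set ℕ := (FH (Cardinal.aleph 1).ord).2

/-! ## `L_ℕ`-translations and the dual translation -/

/-- An `L_ℕ`-translation: it does not relativize quantifiers, commutes with
the logical operations, and is the identity on the arithmetical-syntactic
vocabulary (only the atoms `T`, `D`, `𝐓` may be re-interpreted). -/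
structure LNTrans where
  d : Fml → Fml
  map_eq : ∀ s t, d (Fml.eq s t) = Fml.eq s t
  map_ct : ∀ t, d (Fml.ct t) = Fml.ct t
  map_sentT : ∀ t, d (Fml.sentT t) = Fml.sentT t
  map_sentD : ∀ t, d (Fml.sentD t) = Fml.sentD t
  map_fml1T : ∀ s t, d (Fml.fml1T s t) = Fml.fml1T s t
  map_fml1D : ∀ s t, d (Fml.fml1D s t) = Fml.fml1D s t
  map_not : ∀ A, d A.not = (d A).not
  map_and : ∀ A B, d (A.and B) = (d A).and (d B)
  map_all : ∀ k A, d (Fml.all k A) = Fml.all k (d A)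

/-- `Th₂` `L_ℕ`-interprets `Th₁`. -/
def LNInterp (Th₁ Th₂ : Set Fml) : Prop :=
  ∃ τ : LNTrans, ∀ A : Fml, Proves Th₁ A → Proves Th₂ (τ.d A)

/-- Mutual `L_ℕ`-interpretability. -/
def MutualLNInterp (Th₁ Th₂ : Set Fml) : Prop :=
  LNInterp Th₁ Th₂ ∧ LNInterp Th₂ Th₁

/-- Cantini's dual translation `c`: it preserves the arithmetical vocabulary,
commutes with the logical operations, and maps `T x` to `¬F x`. -/
def Fml.dual : Fml → Fml
  | .eq s t => .eq s t
  | .T t => (Fml.T (.fneg t)).not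
  | .D t => .D t
  | .Tb t => .Tb t
  | .ct t => .ct t
  | .sentT t => .sentT t
  | .sentD t => .sentD t
  | .fml1T s t => .fml1T s t
  | .fml1D s t => .fml1D s t
  | .not A => A.dual.not
  | .and A B => A.dual.and B.dual
  | .all k A => .all k A.dual


/-! ## Coding is injective -/

theorem Term.code_injective : Function.Injective Term.code := by
  intro s
  induction s <;> intro t h <;> cases t <;>
    simp only [Term.code, Nat.pair_eq_pair, Nat.reduceEqDiff, false_and, true_and] at h <;> grind

theorem Fml.code_injective : Function.Injective Fml.code := by
  intro A
  induction A <;> intro B h <;> cases B <;>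
    simp only [Fml.code, Nat.pair_eq_pair, Nat.reduceEqDiff, false_and, true_and,
      Term.code_injective.eq_iff] at h <;> grind

theorem Fml.code_ne_zero (A : Fml) : A.code ≠ 0 := by
  cases A <;> exact (Nat.lt_of_lt_of_le (by norm_num) (Nat.left_le_pair _ _)).ne'

@[simp] theorem decT_code (t : Term) : decT t.code = some t := by
  have h : ∃ s : Term, s.code = t.code := ⟨t, rfl⟩
  rw [decT, dif_pos h, Term.code_injective h.choose_spec]

@[simp] theorem decF_code (A : Fml) : decF A.code = some A := by
  have h : ∃ B : Fml, B.code = A.code := ⟨A, rfl⟩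
  rw [decF, dif_pos h, Fml.code_injective h.choose_spec]

@[simp] theorem opFneg_code (A : Fml) : opFneg A.code = A.not.code := by simp [opFneg]
@[simp] theorem opFand_code (A B : Fml) : opFand A.code B.code = (A.and B).code := by
  simp [opFand]
@[simp] theorem opFall_code (k : ℕ) (A : Fml) : opFall k A.code = (Fml.all k A).code := by
  simp [opFall]
@[simp] theorem opFeq_code (s t : Term) : opFeq s.code t.code = (Fml.eq s t).code := by
  simp [opFeq]
@[simp] theorem opFT_code (t : Term) : opFT t.code = (Fml.T t).code := by simp [opFT]
@[simp] theorem opFD_code (t : Term) : opFD t.code = (Fml.D t).code := by simp [opFD]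
@[simp] theorem opFsub_code (A : Fml) (t : Term) (k : ℕ) :
    opFsub A.code t.code k = (A.subst k t).code := by simp [opFsub]
@[simp] theorem opTneg_code (t : Term) : opTneg t.code = t.fneg.code := by simp [opTneg]
@[simp] theorem opEval_code (t : Term) : opEval t.code = t.val0 (fun _ => 0) := by
  simp [opEval]

/-! ## Satisfaction and substitution in arbitrary structures -/

theorem Term.evalS_congr (S : Struc) {σ τ : ℕ → S.M} (t : Term) (h : ∀ i ∈ t.fv, σ i = τ i) :
    t.evalS S σ = t.evalS S τ := by
  induction t <;> simp_all [Term.evalS, Term.fv]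

theorem Fml.satS_congr (S : Struc) (A : Fml) {σ τ : ℕ → S.M} (h : ∀ i ∈ A.fv, σ i = τ i) :
    Fml.SatS S σ A ↔ Fml.SatS S τ A := by
  induction A generalizing σ τ with
  | not A ih => exact not_congr (ih h)
  | and A B ihA ihB =>
    exact and_congr (ihA fun i hi => h i (Finset.mem_union_left _ hi))
      (ihB fun i hi => h i (Finset.mem_union_right _ hi))
  | all k A ih =>
    refine forall_congr' fun m => ih fun i hi => ?_
    by_cases hik : i = k
    · simp [hik]
    · simp [hik, h i (Finset.mem_erase.2 ⟨hik, hi⟩)]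
  | T t | D t | Tb t | ct t | sentT t | sentD t =>
    simp only [Fml.SatS]
    rw [Term.evalS_congr S t h]
  | eq s t | fml1T s t | fml1D s t =>
    simp only [Fml.SatS]
    rw [Term.evalS_congr S s fun i hi => h i (Finset.mem_union_left _ hi),
      Term.evalS_congr S t fun i hi => h i (Finset.mem_union_right _ hi)]

theorem Term.evalS_subst (S : Struc) (σ : ℕ → S.M) (k : ℕ) (s t : Term) :
    (Term.subst k s t).evalS S σ = t.evalS S (Function.update σ k (s.evalS S σ)) := by
  induction t with
  | var n => by_cases h : n = k <;> simp [Term.subst, Term.evalS, h]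
  | _ => simp_all [Term.subst, Term.evalS]

theorem Fml.satS_subst (S : Struc) (k : ℕ) (s : Term) (hs : s.fv ⊆ {k}) (A : Fml)
    (σ : ℕ → S.M) :
    Fml.SatS S σ (A.subst k s) ↔ Fml.SatS S (Function.update σ k (s.evalS S σ)) A := by
  induction A generalizing σ with
  | not A ih => exact not_congr (ih σ)
  | and A B ihA ihB => exact and_congr (ihA σ) (ihB σ)
  | all m A ih =>
    by_cases hm : m = k
    · subst hm
      simp [Fml.subst, Fml.SatS]
    · simp only [Fml.subst, hm, if_false, Fml.SatS, ih]
      refine forall_congr' fun x => ?_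
      rw [Function.update_comm hm, Term.evalS_congr S (τ := σ) s fun i hi => ?_]
      have hi : i = k := by simpa using hs hi
      simp [hi, Ne.symm hm]
  | _ => simp [Fml.subst, Fml.SatS, Term.evalS_subst]

theorem Fml.satS_close (S : Struc) {A : Fml} (h : ∀ τ, Fml.SatS S τ A) (τ : ℕ → S.M) :
    Fml.SatS S τ A.close := by
  unfold Fml.close
  induction A.fv.sort (· ≤ ·) generalizing τ with
  | nil => exact h τ
  | cons k l ih => exact fun m => ih _

section Connectives

variable (S : Struc) (σ : ℕ → S.M) (A B : Fml)

theorem Fml.satS_imp :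
    Fml.SatS S σ (A.imp B) ↔ (Fml.SatS S σ A → Fml.SatS S σ B) := by
  simp [Fml.imp, Fml.SatS]

theorem Fml.satS_iff :
    Fml.SatS S σ (A.iff B) ↔ (Fml.SatS S σ A ↔ Fml.SatS S σ B) := by
  simp only [Fml.iff, Fml.SatS, Fml.satS_imp]
  tauto

theorem Fml.satS_or :
    Fml.SatS S σ (A.or B) ↔ (Fml.SatS S σ A ∨ Fml.SatS S σ B) := by
  simp only [Fml.or, Fml.SatS]
  tauto

theorem Fml.satS_ex (k : ℕ) :
    Fml.SatS S σ (Fml.ex k A) ↔ ∃ m, Fml.SatS S (Function.update σ k m) A := by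
  simp [Fml.ex, Fml.SatS]

end Connectives

/-! ## Standard models satisfy the base theory and full induction -/

theorem Term.evalS_stdStruc (XT XD XTb : Set ℕ) (σ : ℕ → ℕ) (t : Term) :
    Term.evalS (stdStruc XT XD XTb) σ t = Term.evalS (stdStruc ∅ ∅ ∅) σ t := by
  induction t <;> simp_all [Term.evalS, stdStruc]

theorem Fml.satS_stdStruc_of_arith (XT XD XTb : Set ℕ) (A : Fml) (hT : A.noT) (hD : A.noD)
    (hTb : A.noTb) (σ : ℕ → ℕ) :
    Fml.SatS (stdStruc XT XD XTb) σ A ↔ Fml.SatS (stdStruc ∅ ∅ ∅) σ A := by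
  induction A generalizing σ with
  | T | D | Tb => simp_all [Fml.noT, Fml.noD, Fml.noTb]
  | not A ih => exact not_congr (ih hT hD hTb σ)
  | and A B ihA ihB => exact and_congr (ihA hT.1 hD.1 hTb.1 σ) (ihB hT.2 hD.2 hTb.2 σ)
  | all k A ih => exact forall_congr' fun m => ih hT hD hTb _
  | _ =>
    simp only [Fml.SatS]
    simp only [Term.evalS_stdStruc XT XD XTb]
    rfl

theorem satS_stdStruc_baseTh (XT XD XTb : Set ℕ) (A : Fml) (hA : A ∈ BaseTh) (τ : ℕ → ℕ) :
    Fml.SatS (stdStruc XT XD XTb) τ A := by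
  obtain ⟨hT, hD, hTb, hfv, h⟩ := hA
  rw [Fml.satS_stdStruc_of_arith XT XD XTb A hT hD hTb]
  exact (Fml.satS_congr (stdStruc ∅ ∅ ∅) A (by simp [hfv])).1 h

theorem satS_stdStruc_indTh (XT XD XTb : Set ℕ) (A : Fml) (hA : A ∈ IndTh) (τ : ℕ → ℕ) :
    Fml.SatS (stdStruc XT XD XTb) τ A := by
  obtain ⟨k, A, rfl⟩ := hA
  refine Fml.satS_close (stdStruc XT XD XTb) (fun σ => ?_) τ
  rw [Fml.satS_imp]
  rintro ⟨h0, hstep⟩ (m : ℕ)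
  rw [Fml.satS_subst _ k _ (by simp [Term.fv])] at h0
  induction m with
  | zero => exact h0
  | succ m ih =>
    have h := hstep m
    rw [Fml.satS_imp] at h
    have h := h ih
    rw [Fml.satS_subst _ k _ (by simp [Term.fv])] at h
    have hm : Term.evalS (stdStruc XT XD XTb) (Function.update σ k m) (.succ (.var k)) =
        Nat.succ m :=
      congrArg Nat.succ (Function.update_self (β := fun _ => ℕ) k m σ)
    exact (congrArg (fun ρ => Fml.SatS (stdStruc XT XD XTb) ρ A)
      ((Function.update_idem ..).trans (congrArg (Function.update σ k) hm))).mp h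

/-! ## The inner structure -/

/-- The standard structure except that `evalt` denotes the constant `0`, so that closed terms
denote what `opEval` computes from their codes. -/
noncomputable def innerStruc (XT XD : Set ℕ) : Struc :=
  { stdStruc XT XD ∅ with evalt := fun _ => (0 : ℕ) }

theorem evalS_innerStruc (XT XD : Set ℕ) (σ : ℕ → ℕ) (t : Term) :
    Term.evalS (innerStruc XT XD) σ t = t.val0 σ := by
  induction t <;> simp_all [Term.evalS, Term.val0, innerStruc, stdStruc]

theorem Term.val0_subst (σ : ℕ → ℕ) (k : ℕ) (s t : Term) :
    (Term.subst k s t).val0 σ = t.val0 (Function.update σ k (s.val0 σ)) := by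
  simp only [← evalS_innerStruc ∅ ∅]
  exact Term.evalS_subst (innerStruc ∅ ∅) σ k s t

theorem Term.val0_congr {σ τ : ℕ → ℕ} (t : Term) (h : ∀ i ∈ t.fv, σ i = τ i) :
    t.val0 σ = t.val0 τ := by
  simp only [← evalS_innerStruc ∅ ∅]
  exact Term.evalS_congr (innerStruc ∅ ∅) t h

@[simp] theorem numeral_fv (n : ℕ) : (numeral n).fv = ∅ := by
  induction n <;> simp_all [numeral, Term.fv]

@[simp] theorem numeral_val0 (σ : ℕ → ℕ) (n : ℕ) : (numeral n).val0 σ = n := by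
  induction n <;> simp_all [numeral, Term.val0]

theorem satS_innerStruc_eq (XT XD : Set ℕ) (σ : ℕ → ℕ) (s t : Term) :
    Fml.SatS (innerStruc XT XD) σ (.eq s t) ↔ s.val0 σ = t.val0 σ := by
  rw [← evalS_innerStruc XT XD, ← evalS_innerStruc XT XD]
  rfl

theorem satS_innerStruc_T (XT XD : Set ℕ) (σ : ℕ → ℕ) (t : Term) :
    Fml.SatS (innerStruc XT XD) σ (.T t) ↔ t.val0 σ ∈ XT := by
  rw [← evalS_innerStruc XT XD]
  rfl

theorem satS_innerStruc_D (XT XD : Set ℕ) (σ : ℕ → ℕ) (t : Term) :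
    Fml.SatS (innerStruc XT XD) σ (.D t) ↔ t.val0 σ ∈ XD := by
  rw [← evalS_innerStruc XT XD]
  rfl

theorem satS_innerStruc_ct (XT XD : Set ℕ) (σ : ℕ → ℕ) (t : Term) :
    Fml.SatS (innerStruc XT XD) σ (.ct t) ↔ isCT (t.val0 σ) := by
  rw [← evalS_innerStruc XT XD]
  rfl

theorem satS_innerStruc_subst (XT XD : Set ℕ) (k : ℕ) {s : Term} (hs : s.fv = ∅) (A : Fml)
    (σ : ℕ → ℕ) :
    Fml.SatS (innerStruc XT XD) σ (A.subst k s) ↔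
      Fml.SatS (innerStruc XT XD) (Function.update σ k (s.val0 σ)) A := by
  rw [← evalS_innerStruc XT XD]
  exact Fml.satS_subst (innerStruc XT XD) k s (by simp [hs]) A σ

/-! ## Sentences of `L_D` -/

@[simp] theorem isSentD_eq (s t : Term) : IsSentD (.eq s t) ↔ s.fv = ∅ ∧ t.fv = ∅ := by
  simp [IsSentD, Fml.noTb, Fml.fv, Finset.union_eq_empty]
@[simp] theorem isSentD_T (t : Term) : IsSentD (.T t) ↔ t.fv = ∅ := by
  simp [IsSentD, Fml.noTb, Fml.fv]
@[simp] theorem isSentD_D (t : Term) : IsSentD (.D t) ↔ t.fv = ∅ := by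
  simp [IsSentD, Fml.noTb, Fml.fv]
@[simp] theorem isSentD_not (A : Fml) : IsSentD A.not ↔ IsSentD A := by
  simp [IsSentD, Fml.noTb, Fml.fv]
@[simp] theorem isSentD_and (A B : Fml) : IsSentD (A.and B) ↔ IsSentD A ∧ IsSentD B := by
  simp only [IsSentD, Fml.noTb, Fml.fv, Finset.union_eq_empty]
  tauto

theorem isSentD_all {k : ℕ} {A : Fml} (hTb : A.noTb) (hA : A.fv ⊆ {k}) :
    IsSentD (.all k A) := by
  refine ⟨hTb, ?_⟩
  ext i
  simp only [Fml.fv, Finset.mem_erase, Finset.notMem_empty, iff_false, not_and]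
  exact fun hik hi => hik (by simpa using hA hi)

theorem Term.fv_subst (k : ℕ) {s : Term} (hs : s.fv = ∅) (t : Term) :
    (Term.subst k s t).fv = t.fv.erase k := by
  induction t with
  | var n =>
    by_cases h : n = k
    · simp [Term.subst, h, hs, Term.fv]
    · ext i
      simp only [Term.subst, h, if_false, Term.fv, Finset.mem_erase, Finset.mem_singleton]
      grind
  | _ => simp_all [Term.subst, Term.fv, Finset.erase_union_distrib]

theorem Fml.fv_subst (k : ℕ) {s : Term} (hs : s.fv = ∅) (A : Fml) :
    (A.subst k s).fv = A.fv.erase k := by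
  induction A with
  | all m A ih =>
    by_cases h : m = k
    · simp [Fml.subst, h, Fml.fv]
    · simp [Fml.subst, h, Fml.fv, ih, Finset.erase_right_comm]
  | _ => simp_all [Fml.subst, Fml.fv, Term.fv_subst k hs, Finset.erase_union_distrib]

theorem Fml.noTb_subst (k : ℕ) (s : Term) {A : Fml} (hA : A.noTb) : (A.subst k s).noTb := by
  induction A with
  | all m A ih =>
    by_cases h : m = k
    · simpa [Fml.subst, h] using hA
    · simpa [Fml.subst, h, Fml.noTb] using ih hA
  | _ => simp_all [Fml.subst, Fml.noTb]

theorem isSentD_subst {k : ℕ} {A : Fml} (hTb : A.noTb) (hA : A.fv ⊆ {k}) {s : Term}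
    (hs : s.fv = ∅) : IsSentD (A.subst k s) := by
  refine ⟨Fml.noTb_subst k s hTb, ?_⟩
  rw [Fml.fv_subst k hs]
  exact (isSentD_all hTb hA).2

/-! ## Determinate truth and falsity -/

/-- `Det b σ A`: under the assignment `σ`, the formula `A` is determinate with truth value `b`.
This is the least Strong Kleene style valuation for which `T t` has the value of the sentence
denoted by `t`, and `D t` is true if the sentence denoted by `t` has a value. -/
inductive Det : Bool → (ℕ → ℕ) → Fml → Prop
  | eq {b σ s t} (h : b = true ↔ s.val0 σ = t.val0 σ) : Det b σ (.eq s t)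
  | T {b σ t} (A : Fml) (hA : IsSentD A) (ht : A.code = t.val0 σ)
      (h : Det b (fun _ => 0) A) : Det b σ (.T t)
  | D {b σ t} (A : Fml) (hA : IsSentD A) (ht : A.code = t.val0 σ)
      (h : Det b (fun _ => 0) A) : Det true σ (.D t)
  | not {b σ A} (h : Det (!b) σ A) : Det b σ (.not A)
  | and_true {σ A B} (hA : Det true σ A) (hB : Det true σ B) : Det true σ (.and A B)
  | and_left {σ A B} (hA : Det false σ A) : Det false σ (.and A B)
  | and_right {σ A B} (hB : Det false σ B) : Det false σ (.and A B)
  | all_true {σ k A} (h : ∀ m, Det true (Function.update σ k m) A) : Det true σ (.all k A)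
  | all_false {σ k A} (m : ℕ) (h : Det false (Function.update σ k m) A) :
      Det false σ (.all k A)

theorem det_eq_iff {b σ s t} : Det b σ (.eq s t) ↔ (b = true ↔ s.val0 σ = t.val0 σ) :=
  ⟨fun h => by cases h; assumption, .eq⟩

theorem det_T_iff {b σ t} : Det b σ (.T t) ↔
    ∃ A : Fml, IsSentD A ∧ A.code = t.val0 σ ∧ Det b (fun _ => 0) A :=
  ⟨fun h => by cases h with | T A hA ht h => exact ⟨A, hA, ht, h⟩,
    fun ⟨A, hA, ht, h⟩ => .T A hA ht h⟩

theorem det_D_iff {b σ t} : Det b σ (.D t) ↔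
    b = true ∧ ∃ A : Fml, IsSentD A ∧ A.code = t.val0 σ ∧ ∃ c, Det c (fun _ => 0) A :=
  ⟨fun h => by cases h with | D A hA ht h => exact ⟨rfl, A, hA, ht, _, h⟩,
    fun ⟨hb, A, hA, ht, _, h⟩ => hb ▸ .D A hA ht h⟩

theorem det_not_iff {b σ A} : Det b σ (.not A) ↔ Det (!b) σ A :=
  ⟨fun h => by cases h; assumption, .not⟩

theorem det_true_and_iff {σ A B} : Det true σ (.and A B) ↔ Det true σ A ∧ Det true σ B :=
  ⟨fun h => by cases h; constructor <;> assumption, fun h => .and_true h.1 h.2⟩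

theorem det_false_and_iff {σ A B} : Det false σ (.and A B) ↔ Det false σ A ∨ Det false σ B :=
  ⟨fun h => by cases h <;> tauto, fun h => h.elim .and_left .and_right⟩

theorem det_true_all_iff {σ k A} :
    Det true σ (.all k A) ↔ ∀ m, Det true (Function.update σ k m) A :=
  ⟨fun h => by cases h; assumption, .all_true⟩

theorem det_false_all_iff {σ k A} :
    Det false σ (.all k A) ↔ ∃ m, Det false (Function.update σ k m) A :=
  ⟨fun h => by cases h with | all_false m h => exact ⟨m, h⟩, fun ⟨m, h⟩ => .all_false m h⟩

theorem Det.unique {b c : Bool} {σ : ℕ → ℕ} {A : Fml} (h : Det b σ A) (h' : Det c σ A) :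
    b = c := by
  induction h generalizing c with
  | eq h => rw [det_eq_iff] at h'; exact Bool.eq_iff_iff.2 (h.trans h'.symm)
  | T A _ ht _ ih =>
    obtain ⟨B, -, hB, h'⟩ := det_T_iff.1 h'
    obtain rfl := Fml.code_injective (hB.trans ht.symm)
    exact ih h'
  | D => exact (det_D_iff.1 h').1.symm
  | not _ ih => exact Bool.not_inj (ih (det_not_iff.1 h'))
  | and_true _ _ ihA ihB =>
    cases c with
    | true => rfl
    | false => exact (det_false_and_iff.1 h').elim ihA ihB
  | and_left _ ih =>
    cases c with
    | true => exact ih (det_true_and_iff.1 h').1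
    | false => rfl
  | and_right _ ih =>
    cases c with
    | true => exact ih (det_true_and_iff.1 h').2
    | false => rfl
  | all_true _ ih =>
    cases c with
    | true => rfl
    | false => exact (det_false_all_iff.1 h').elim fun m hm => ih m hm
  | all_false m _ ih =>
    cases c with
    | true => exact ih (det_true_all_iff.1 h' m)
    | false => rfl

theorem det_subst {b : Bool} (k : ℕ) {s : Term} (hs : s.fv = ∅) (A : Fml) (σ : ℕ → ℕ) :
    Det b σ (A.subst k s) ↔ Det b (Function.update σ k (s.val0 σ)) A := by
  induction A generalizing b σ with
  | eq | T | D => simp only [Fml.subst, det_eq_iff, det_T_iff, det_D_iff, Term.val0_subst]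
  | not A ih => simp only [Fml.subst, det_not_iff, ih]
  | and A B ihA ihB =>
    cases b <;> simp only [Fml.subst, det_true_and_iff, det_false_and_iff, ihA, ihB]
  | all m A ih =>
    by_cases hm : m = k
    · subst hm
      cases b <;> simp [Fml.subst, det_true_all_iff, det_false_all_iff]
    · have key : ∀ x : ℕ, Function.update (Function.update σ m x) k
          (s.val0 (Function.update σ m x)) =
          Function.update (Function.update σ k (s.val0 σ)) m x := fun x => by
        rw [Function.update_comm hm, Term.val0_congr (τ := σ) s (by simp [hs])]
      cases b <;>
        simp only [Fml.subst, hm, if_false, det_true_all_iff, det_false_all_iff, ih, key]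
  | _ => constructor <;> intro h <;> cases h

/-- The codes of determinate sentences. -/
def detSet : Set ℕ := {n | ∃ A : Fml, A.code = n ∧ IsSentD A ∧ ∃ b, Det b (fun _ => 0) A}

/-- The codes of determinately true sentences, together with the set `Z`. -/
def innerT (Z : Set ℕ) : Set ℕ :=
  {n | ∃ A : Fml, A.code = n ∧ IsSentD A ∧ Det true (fun _ => 0) A} ∪ Z

/-- The codes of sentences true when `T` is read as `innerT Z` and `D` as `detSet`. -/
def outerT (Z : Set ℕ) : Set ℕ :=
  {n | ∃ A : Fml, A.code = n ∧ IsSentD A ∧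
    Fml.SatS (innerStruc (innerT Z) detSet) (fun _ => (0 : ℕ)) A}

theorem code_mem_detSet {A : Fml} :
    A.code ∈ detSet ↔ IsSentD A ∧ ∃ b, Det b (fun _ => 0) A := by
  simp [detSet, Fml.code_injective.eq_iff]

theorem code_mem_innerT {Z : Set ℕ} {A : Fml} :
    A.code ∈ innerT Z ↔ (IsSentD A ∧ Det true (fun _ => 0) A) ∨ A.code ∈ Z := by
  simp [innerT, Fml.code_injective.eq_iff]

theorem code_mem_outerT {Z : Set ℕ} {A : Fml} :
    A.code ∈ outerT Z ↔ IsSentD A ∧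
      Fml.SatS (innerStruc (innerT Z) detSet) (fun _ => (0 : ℕ)) A := by
  simp [outerT, Fml.code_injective.eq_iff]

theorem T_mem_outerT {Z : Set ℕ} {t : Term} (ht : t.fv = ∅) :
    (Fml.T t).code ∈ outerT Z ↔ t.val0 (fun _ => 0) ∈ innerT Z := by
  rw [code_mem_outerT, isSentD_T, satS_innerStruc_T, and_iff_right ht]

theorem Det.satS_iff {Z : Set ℕ} (hZ : Disjoint detSet Z) {b : Bool} {σ : ℕ → ℕ} {A : Fml}
    (h : Det b σ A) :
    Fml.SatS (innerStruc (innerT Z) detSet) σ A ↔ b = true := by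
  induction h with
  | eq h => exact (satS_innerStruc_eq ..).trans h.symm
  | @T b σ t A hA ht h ih =>
    rw [satS_innerStruc_T, ← ht, code_mem_innerT]
    have hAZ : A.code ∉ Z := Set.disjoint_left.1 hZ (code_mem_detSet.2 ⟨hA, _, h⟩)
    refine ⟨fun h' => h.unique (h'.resolve_right hAZ).2, ?_⟩
    rintro rfl
    exact .inl ⟨hA, h⟩
  | @D b σ t A hA ht h ih =>
    rw [satS_innerStruc_D, ← ht, code_mem_detSet]
    exact iff_of_true ⟨hA, _, h⟩ rfl
  | not _ ih => simp [Fml.SatS, ih]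
  | and_true _ _ ihA ihB => simp [Fml.SatS, ihA, ihB]
  | and_left _ ih => simp [Fml.SatS, ih]
  | and_right _ ih => simp [Fml.SatS, ih]
  | all_true _ ih => exact iff_of_true (fun m => (ih m).2 rfl) rfl
  | all_false m _ ih => exact iff_of_false (fun h => by simpa using ih.1 (h m)) (by simp)

/-- The standard model with `outerT Z` and `detSet` as the extensions of `T` and `D`. -/
noncomputable abbrev detModel (Z : Set ℕ) : Struc := stdStruc (outerT Z) detSet ∅

theorem code_mem_outerT_not {Z : Set ℕ} {A : Fml} (hA : IsSentD A) :
    A.not.code ∈ outerT Z ↔ A.code ∉ outerT Z := by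
  simp only [code_mem_outerT, isSentD_not, hA, true_and]
  rfl

theorem not_mem_outerT_iff_det_false {Z : Set ℕ} (hZ : Disjoint detSet Z) {A : Fml}
    (hA : IsSentD A) :
    A.code ∈ detSet ∧ A.not.code ∈ outerT Z ↔ Det false (fun _ => 0) A := by
  rw [code_mem_outerT_not hA, code_mem_outerT, code_mem_detSet]
  simp only [hA, true_and]
  constructor
  · rintro ⟨⟨b, hb⟩, h⟩
    cases b with
    | true => exact absurd ((hb.satS_iff hZ).2 rfl) h
    | false => exact hb
  · exact fun h => ⟨⟨_, h⟩, fun h' => by simpa using (h.satS_iff hZ).1 h'⟩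

theorem code_mem_outerT_subst {Z : Set ℕ} {k : ℕ} {A : Fml} (hTb : A.noTb) (hA : A.fv ⊆ {k})
    {t : Term} (ht : t.fv = ∅) :
    (A.subst k t).code ∈ outerT Z ↔ Fml.SatS (innerStruc (innerT Z) detSet)
      (Function.update (fun _ => (0 : ℕ)) k (t.val0 fun _ => 0)) A := by
  rw [code_mem_outerT, and_iff_right (isSentD_subst hTb hA ht), satS_innerStruc_subst _ _ k ht]

theorem code_mem_detSet_subst {k : ℕ} {A : Fml} (hTb : A.noTb) (hA : A.fv ⊆ {k})
    {t : Term} (ht : t.fv = ∅) :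
    (A.subst k t).code ∈ detSet ↔
      ∃ b, Det b (Function.update (fun _ => 0) k (t.val0 fun _ => 0)) A := by
  simp only [code_mem_detSet, and_iff_right (isSentD_subst hTb hA ht), det_subst k ht]

theorem detModel_axT1 (Z : Set ℕ) (τ : ℕ → ℕ) : Fml.SatS (detModel Z) τ axT1 := by
  simp only [axT1, Fml.SatS, Fml.satS_imp, Fml.satS_iff, Term.evalS, v0, v1]
  rintro _ _ ⟨⟨s, rfl, hs⟩, ⟨t, rfl, ht⟩⟩
  change opFeq s.code t.code ∈ outerT Z ↔ opEval s.code = opEval t.code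
  simp [code_mem_outerT, satS_innerStruc_eq, hs, ht]

theorem detModel_axT2p (Z : Set ℕ) (τ : ℕ → ℕ) :
    Fml.SatS (detModel Z) τ (axT2p Fml.D dcodePrim) := by
  simp only [axT2p, dcodePrim, Fml.SatS, Fml.satS_imp, Fml.satS_iff, Term.evalS, v0]
  rintro _ ⟨t, rfl, ht⟩
  change opEval t.code ∈ detSet ↔ opFD t.code ∈ outerT Z
  simp [code_mem_outerT, satS_innerStruc_D, ht]

theorem detModel_axT3 {Z : Set ℕ} (hZ : Disjoint detSet Z) (τ : ℕ → ℕ) :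
    Fml.SatS (detModel Z) τ (axT3 Fml.D) := by
  simp only [axT3, tTT, tmT, Fml.SatS, Fml.satS_imp, Fml.satS_iff, Term.evalS, v0]
  rintro _ ⟨t, rfl, ht⟩
  change opEval t.code ∈ detSet → (opFT t.code ∈ outerT Z ↔ opEval t.code ∈ outerT Z)
  rw [opFT_code, T_mem_outerT ht, opEval_code]
  rintro hD
  obtain ⟨A, hAt, hA, b, hb⟩ := id hD
  have hAZ : A.code ∉ Z := hAt ▸ Set.disjoint_left.1 hZ hD
  rw [← hAt, code_mem_innerT, code_mem_outerT, hb.satS_iff hZ]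
  simp only [hA, hAZ, true_and, or_false]
  exact ⟨hb.unique, fun h => h ▸ hb⟩

theorem detModel_axT4 (Z : Set ℕ) (τ : ℕ → ℕ) :
    Fml.SatS (detModel Z) τ (axT4 Fml.sentD) := by
  simp only [axT4, Fml.SatS, Fml.satS_imp, Fml.satS_iff, Term.evalS, v0]
  rintro _ ⟨A, rfl, hA⟩
  change opFneg A.code ∈ outerT Z ↔ A.code ∉ outerT Z
  rw [opFneg_code, code_mem_outerT_not hA]

theorem detModel_axT5 (Z : Set ℕ) (τ : ℕ → ℕ) :
    Fml.SatS (detModel Z) τ (axT5 Fml.sentD) := by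
  simp only [axT5, Fml.SatS, Fml.satS_imp, Fml.satS_iff, Term.evalS, v0, v1]
  rintro _ _ ⟨⟨A, rfl, hA⟩, ⟨B, rfl, hB⟩⟩
  change opFand A.code B.code ∈ outerT Z ↔ A.code ∈ outerT Z ∧ B.code ∈ outerT Z
  simp [code_mem_outerT, hA, hB, Fml.SatS]

theorem detModel_axT6 (Z : Set ℕ) (τ : ℕ → ℕ) :
    Fml.SatS (detModel Z) τ (axT6 Fml.fml1D) := by
  simp only [axT6, Fml.SatS, Fml.satS_imp, Fml.satS_iff, Term.evalS, v0, v1, v2]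
  rintro (k : ℕ) _ ⟨A, rfl, hTb, hA⟩
  replace hA : A.fv ⊆ {k} := hA
  change opFall k A.code ∈ outerT Z ↔ ∀ c, isCT c → opFsub A.code c k ∈ outerT Z
  rw [opFall_code, code_mem_outerT, and_iff_right (isSentD_all hTb hA)]
  constructor
  · rintro h _ ⟨t, rfl, ht⟩
    rw [opFsub_code, code_mem_outerT_subst hTb hA ht]
    exact h _
  · intro h (m : ℕ)
    have hm := h _ ⟨numeral m, rfl, numeral_fv m⟩
    rwa [opFsub_code, code_mem_outerT_subst hTb hA (numeral_fv m), numeral_val0] at hm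

theorem detModel_axD1 (Z : Set ℕ) (τ : ℕ → ℕ) : Fml.SatS (detModel Z) τ (axD1 Fml.D) := by
  simp only [axD1, Fml.SatS, Fml.satS_imp, Term.evalS, v0, v1]
  rintro _ _ ⟨⟨s, rfl, hs⟩, ⟨t, rfl, ht⟩⟩
  change opFeq s.code t.code ∈ detSet
  rw [opFeq_code, code_mem_detSet, isSentD_eq]
  exact ⟨⟨hs, ht⟩, decide _, .eq decide_eq_true_iff⟩

theorem detModel_axD2 (Z : Set ℕ) (τ : ℕ → ℕ) : Fml.SatS (detModel Z) τ (axD2 Fml.D) := by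
  simp only [axD2, tmT, Fml.SatS, Fml.satS_imp, Fml.satS_iff, Term.evalS, v0]
  rintro _ ⟨t, rfl, ht⟩
  change opFT t.code ∈ detSet ↔ opEval t.code ∈ detSet
  rw [opFT_code, opEval_code, code_mem_detSet, isSentD_T, and_iff_right ht]
  constructor
  · rintro ⟨b, h⟩
    obtain ⟨A, hA, hAt, h⟩ := det_T_iff.1 h
    exact ⟨A, hAt, hA, b, h⟩
  · rintro ⟨A, hAt, hA, b, h⟩
    exact ⟨b, .T A hA hAt h⟩

theorem detModel_axD3 (Z : Set ℕ) (τ : ℕ → ℕ) :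
    Fml.SatS (detModel Z) τ (axD3 Fml.D dcodePrim) := by
  simp only [axD3, dcodePrim, Fml.SatS, Fml.satS_imp, Fml.satS_iff, Term.evalS, v0]
  rintro _ ⟨t, rfl, ht⟩
  change opFD t.code ∈ detSet ↔ opEval t.code ∈ detSet
  rw [opFD_code, opEval_code, code_mem_detSet, isSentD_D, and_iff_right ht]
  constructor
  · rintro ⟨b, h⟩
    obtain ⟨-, A, hA, hAt, h⟩ := det_D_iff.1 h
    exact ⟨A, hAt, hA, h⟩
  · rintro ⟨A, hAt, hA, b, h⟩
    exact ⟨true, .D A hA hAt h⟩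

theorem detModel_axD4 (Z : Set ℕ) (τ : ℕ → ℕ) :
    Fml.SatS (detModel Z) τ (axD4 Fml.D Fml.sentD) := by
  simp only [axD4, Fml.SatS, Fml.satS_imp, Fml.satS_iff, Term.evalS, v0]
  rintro _ ⟨A, rfl, hA⟩
  change opFneg A.code ∈ detSet ↔ A.code ∈ detSet
  simp [code_mem_detSet, det_not_iff, or_comm]

theorem detModel_axD5 {Z : Set ℕ} (hZ : Disjoint detSet Z) (τ : ℕ → ℕ) :
    Fml.SatS (detModel Z) τ (axD5 Fml.D Fml.sentD) := by
  simp only [axD5, Fml.SatS, Fml.satS_imp, Fml.satS_iff, Fml.satS_or, Term.evalS, v0, v1]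
  rintro _ _ ⟨⟨A, rfl, hA⟩, ⟨B, rfl, hB⟩⟩
  change opFand A.code B.code ∈ detSet ↔ (((A.code ∈ detSet ∧ B.code ∈ detSet) ∨
    (A.code ∈ detSet ∧ opFneg A.code ∈ outerT Z)) ∨
    (B.code ∈ detSet ∧ opFneg B.code ∈ outerT Z))
  rw [opFand_code, opFneg_code, opFneg_code, not_mem_outerT_iff_det_false hZ hA,
    not_mem_outerT_iff_det_false hZ hB]
  simp only [code_mem_detSet, isSentD_and, hA, hB, true_and, Bool.exists_bool,
    det_true_and_iff, det_false_and_iff]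
  tauto

theorem detModel_axD6 {Z : Set ℕ} (hZ : Disjoint detSet Z) (τ : ℕ → ℕ) :
    Fml.SatS (detModel Z) τ (axD6 Fml.D Fml.fml1D) := by
  simp only [axD6, Fml.SatS, Fml.satS_imp, Fml.satS_iff, Fml.satS_or, Fml.satS_ex, Term.evalS,
    v0, v1, v2]
  rintro (k : ℕ) _ ⟨A, rfl, hTb, hA⟩
  replace hA : A.fv ⊆ {k} := hA
  change opFall k A.code ∈ detSet ↔ (∀ c, isCT c → opFsub A.code c k ∈ detSet) ∨
    ∃ c, isCT c ∧ opFsub A.code c k ∈ detSet ∧ opFneg (opFsub A.code c k) ∈ outerT Z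
  have hfalse : (∃ c, isCT c ∧ opFsub A.code c k ∈ detSet ∧
      opFneg (opFsub A.code c k) ∈ outerT Z) ↔
      ∃ m, Det false (Function.update (fun _ => 0) k m) A := by
    constructor
    · rintro ⟨_, ⟨t, rfl, ht⟩, h⟩
      rw [opFsub_code, opFneg_code, not_mem_outerT_iff_det_false hZ (isSentD_subst hTb hA ht),
        det_subst k ht] at h
      exact ⟨_, h⟩
    · rintro ⟨m, h⟩
      refine ⟨_, ⟨numeral m, rfl, numeral_fv m⟩, ?_⟩
      rwa [opFsub_code, opFneg_code, not_mem_outerT_iff_det_false hZ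
        (isSentD_subst hTb hA (numeral_fv m)), det_subst k (numeral_fv m), numeral_val0]
  have hall : (∀ c, isCT c → opFsub A.code c k ∈ detSet) ↔
      ∀ m, ∃ b, Det b (Function.update (fun _ => 0) k m) A := by
    constructor
    · intro h m
      have hm := h _ ⟨numeral m, rfl, numeral_fv m⟩
      rwa [opFsub_code, code_mem_detSet_subst hTb hA (numeral_fv m), numeral_val0] at hm
    · rintro h _ ⟨t, rfl, ht⟩
      rw [opFsub_code, code_mem_detSet_subst hTb hA ht]
      exact h _
  rw [hfalse, hall, opFall_code, code_mem_detSet, and_iff_right (isSentD_all hTb hA)]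
  simp only [Bool.exists_bool, det_true_all_iff, det_false_all_iff]
  grind

theorem detModel_axR1 (Z : Set ℕ) (τ : ℕ → ℕ) :
    Fml.SatS (detModel Z) τ (axR1 Fml.fml1D) := by
  simp only [axR1, Fml.SatS, Fml.satS_imp, Fml.satS_iff, Term.evalS, v0, v1, v2, v3]
  rintro (k : ℕ) _ _ _ ⟨⟨A, rfl, hTb, hA⟩, ⟨s, rfl, hs⟩, ⟨t, rfl, ht⟩⟩
  replace hA : A.fv ⊆ {k} := hA
  change opEval s.code = opEval t.code →
    (opFsub A.code s.code k ∈ outerT Z ↔ opFsub A.code t.code k ∈ outerT Z)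
  simp only [opEval_code, opFsub_code, code_mem_outerT_subst hTb hA, hs, ht]
  exact fun h => h ▸ Iff.rfl

theorem detModel_axR2 (Z : Set ℕ) (τ : ℕ → ℕ) :
    Fml.SatS (detModel Z) τ (axR2 Fml.D Fml.fml1D) := by
  simp only [axR2, Fml.SatS, Fml.satS_imp, Fml.satS_iff, Term.evalS, v0, v1, v2, v3]
  rintro (k : ℕ) _ _ _ ⟨⟨A, rfl, hTb, hA⟩, ⟨s, rfl, hs⟩, ⟨t, rfl, ht⟩⟩
  replace hA : A.fv ⊆ {k} := hA
  change opEval s.code = opEval t.code →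
    (opFsub A.code s.code k ∈ detSet ↔ opFsub A.code t.code k ∈ detSet)
  simp only [opEval_code, opFsub_code, code_mem_detSet_subst hTb hA, hs, ht]
  exact fun h => h ▸ Iff.rfl

theorem detModel_models_CDplus {Z : Set ℕ} (hZ : Disjoint detSet Z) (A : Fml)
    (hA : A ∈ CDplus) (τ : ℕ → ℕ) : Fml.SatS (detModel Z) τ A := by
  rcases hA with (hA | hA) | hA
  · exact satS_stdStruc_baseTh _ _ _ A hA τ
  · exact satS_stdStruc_indTh _ _ _ A hA τ
  · rcases hA with rfl | rfl | rfl | rfl | rfl | rfl | rfl | rfl | rfl | rfl | rfl | rfl | rfl | rfl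
    exacts [detModel_axT1 Z τ, detModel_axT2p Z τ, detModel_axT3 hZ τ, detModel_axT4 Z τ,
      detModel_axT5 Z τ, detModel_axT6 Z τ, detModel_axD1 Z τ, detModel_axD2 Z τ,
      detModel_axD3 Z τ, detModel_axD4 Z τ, detModel_axD5 hZ τ, detModel_axD6 hZ τ,
      detModel_axR1 Z τ, detModel_axR2 Z τ]

theorem satS_detModel_of_proves {Z : Set ℕ} (hZ : Disjoint detSet Z) {A : Fml}
    (h : Proves CDplus A) : Fml.SatS (detModel Z) (fun _ => (0 : ℕ)) A :=
  h (detModel Z) _ (detModel_models_CDplus hZ)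

/-! ## Iterated truth in the models -/

theorem TT_mem_outerT {Z : Set ℕ} (n : ℕ) :
    opFT (opNum n) ∈ outerT Z ↔ n ∈ innerT Z := by
  rw [opNum, opFT_code, T_mem_outerT (numeral_fv n), numeral_val0]

theorem TF_mem_outerT {Z : Set ℕ} (n : ℕ) :
    opFT (opTneg (opNum n)) ∈ outerT Z ↔ opFneg n ∈ innerT Z := by
  rw [opNum, opTneg_code, opFT_code, T_mem_outerT (by simp [Term.fv]), Term.val0, numeral_val0]

theorem satS_innerStruc_not (XT XD : Set ℕ) (σ : ℕ → ℕ) (A : Fml) :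
    Fml.SatS (innerStruc XT XD) σ A.not ↔ ¬ Fml.SatS (innerStruc XT XD) σ A := Iff.rfl

theorem satS_innerStruc_all_ct_imp (XT XD : Set ℕ) (σ : ℕ → ℕ) (B : Fml) :
    Fml.SatS (innerStruc XT XD) σ (.all 0 ((Fml.ct (.var 0)).imp B)) ↔
      ∀ t : Term, t.fv = ∅ →
        Fml.SatS (innerStruc XT XD) (Function.update σ 0 t.code : ℕ → ℕ) B := by
  have h (m : ℕ) : Fml.SatS (innerStruc XT XD) (Function.update σ 0 m : ℕ → ℕ)
      ((Fml.ct (.var 0)).imp B) ↔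
      (isCT m → Fml.SatS (innerStruc XT XD) (Function.update σ 0 m : ℕ → ℕ) B) := by
    refine (Fml.satS_imp ..).trans (imp_congr_left ((satS_innerStruc_ct ..).trans ?_))
    rw [Term.val0, Function.update_self]
  refine (forall_congr' h : (∀ m : ℕ, _) ↔ ∀ m : ℕ, _).trans ⟨?_, ?_⟩
  · exact fun h t ht => h t.code ⟨t, rfl, ht⟩
  · rintro h _ ⟨t, rfl, ht⟩
    exact h t ht

theorem opUall_mem_outerT {Z : Set ℕ} (k : ℕ) (A : Fml) :
    opUall k A.code ∈ outerT Z ↔ ∀ t : Term, t.fv = ∅ → (A.subst k t).code ∈ innerT Z := by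
  rw [opUall, code_mem_outerT, and_iff_right, satS_innerStruc_all_ct_imp]
  · simp only [satS_innerStruc_T, Term.val0, numeral_val0, Function.update_self, opFsub_code]
  · refine isSentD_all ?_ ?_ <;> simp [Fml.imp, Fml.noTb, Fml.fv, Term.fv]

theorem opUex_mem_outerT {Z : Set ℕ} (k : ℕ) (A : Fml) :
    opUex k A.code ∈ outerT Z ↔
      ∃ t : Term, t.fv = ∅ ∧ (A.subst k t).not.code ∈ innerT Z := by
  rw [opUex, code_mem_outerT, and_iff_right]
  · refine (not_congr (satS_innerStruc_all_ct_imp ..)).trans ?_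
    simp only [satS_innerStruc_not, satS_innerStruc_T, Term.val0, numeral_val0,
      Function.update_self, opFsub_code, opFneg_code]
    push Not
    rfl
  · rw [isSentD_not]
    refine isSentD_all ?_ ?_ <;> simp [Fml.imp, Fml.noTb, Fml.fv, Term.fv]

/-! ## An indeterminate sentence -/

/-- The sentence `T 0`, which is indeterminate because `0` does not code a sentence. -/
def Tzero : Fml := .T .zero

theorem isSentT_Tzero : IsSentT Tzero := by
  simp [IsSentT, Tzero, Fml.noD, Fml.noTb, Fml.fv, Term.fv]

theorem isSentTC_Tzero : isSentTC Tzero.code := ⟨Tzero, rfl, isSentT_Tzero⟩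

theorem not_det_Tzero (b : Bool) (σ : ℕ → ℕ) : ¬ Det b σ Tzero := fun h => by
  obtain ⟨A, -, hA, -⟩ := det_T_iff.1 h
  exact A.code_ne_zero hA

theorem disjoint_detSet_zero : Disjoint detSet {0} := by
  rw [Set.disjoint_singleton_right]
  rintro ⟨A, hA, -⟩
  exact A.code_ne_zero hA

theorem disjoint_detSet_Tzero : Disjoint detSet {Tzero.code, Tzero.not.code} := by
  simp [code_mem_detSet, det_not_iff, not_det_Tzero]

/-- When exactly `T 0` and `¬ T 0` are added to the inner extension of truth, no other
indeterminate sentence is in it. -/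
theorem mem_innerT_of_not_det {A : Fml} (hA : ¬ Det true (fun _ => 0) A) :
    A.code ∈ innerT {Tzero.code, Tzero.not.code} ↔ A = Tzero ∨ A = Tzero.not := by
  simp [code_mem_innerT, hA, Fml.code_injective.eq_iff]

theorem Tzero_mem_innerT : Tzero.code ∈ innerT {Tzero.code, Tzero.not.code} :=
  .inr (.inl rfl)

theorem Tzero_not_mem_innerT : Tzero.not.code ∈ innerT {Tzero.code, Tzero.not.code} :=
  .inr (.inr rfl)

theorem not_proves_TTT_imp_TT :
    ¬ Proves CDplus (Fml.all 0 ((Fml.ct v0).imp ((sTT (tmT v0)).imp (tTT v0)))) := by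
  intro h
  have h := satS_detModel_of_proves disjoint_detSet_Tzero h
  simp only [sTT, tTT, tmT, Fml.SatS, Fml.satS_imp, Term.evalS, v0] at h
  have h : opFT (opNum (opFT Term.zero.code)) ∈ outerT {Tzero.code, Tzero.not.code} →
      opFT Term.zero.code ∈ outerT {Tzero.code, Tzero.not.code} :=
    h _ ⟨.zero, rfl, rfl⟩
  rw [TT_mem_outerT, opFT_code, T_mem_outerT rfl] at h
  obtain ⟨A, hA, -⟩ | hA | hA := h Tzero_mem_innerT
  · exact A.code_ne_zero hA
  · exact Tzero.code_ne_zero hA.symm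
  · exact Tzero.not.code_ne_zero hA.symm

theorem not_proves_TT_imp_TTT :
    ¬ Proves CDplus (Fml.all 0 ((Fml.ct v0).imp ((tTT v0).imp (sTT (tmT v0))))) := by
  intro h
  have h := satS_detModel_of_proves disjoint_detSet_zero h
  simp only [sTT, tTT, tmT, Fml.SatS, Fml.satS_imp, Term.evalS, v0] at h
  have h : opFT Term.zero.code ∈ outerT {0} → opFT (opNum (opFT Term.zero.code)) ∈ outerT {0} :=
    h _ ⟨.zero, rfl, rfl⟩
  rw [TT_mem_outerT, opFT_code, T_mem_outerT rfl] at h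
  obtain ⟨-, hT⟩ | hT := code_mem_innerT.1 (h (.inr rfl))
  · exact not_det_Tzero _ _ hT
  · exact Fml.code_ne_zero _ hT

theorem not_proves_axT9 : ¬ Proves CDplus axT9 := by
  intro h
  have h := satS_detModel_of_proves disjoint_detSet_Tzero h
  simp only [axT9, sTT, tmT, Fml.SatS, Fml.satS_imp, Fml.satS_iff, Term.evalS, v0] at h
  have h : ∀ a : ℕ, isSentTC a →
      (opFT (opNum a) ∈ outerT {Tzero.code, Tzero.not.code} ↔
      opFT (opNum (opFneg (opFneg a))) ∈ outerT {Tzero.code, Tzero.not.code}) := h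
  specialize h Tzero.code isSentTC_Tzero
  rw [TT_mem_outerT, TT_mem_outerT, opFneg_code, opFneg_code,
    mem_innerT_of_not_det (A := Tzero.not.not)] at h
  · simpa [Tzero] using h.1 Tzero_mem_innerT
  · simp [det_not_iff, not_det_Tzero]

theorem not_proves_axT10 : ¬ Proves CDplus axT10 := by
  intro h
  have h := satS_detModel_of_proves disjoint_detSet_Tzero h
  simp only [axT10, sTT, tmT, Fml.SatS, Fml.satS_imp, Fml.satS_iff, Term.evalS, v0, v1] at h
  have h : ∀ a b : ℕ, isSentTC a ∧ isSentTC b →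
      (opFT (opNum (opFand a b)) ∈ outerT {Tzero.code, Tzero.not.code} ↔
      opFT (opNum a) ∈ outerT {Tzero.code, Tzero.not.code} ∧
        opFT (opNum b) ∈ outerT {Tzero.code, Tzero.not.code}) := h
  specialize h Tzero.code Tzero.code ⟨isSentTC_Tzero, isSentTC_Tzero⟩
  rw [TT_mem_outerT, TT_mem_outerT, opFand_code, mem_innerT_of_not_det] at h
  · simpa [Tzero] using h.2 ⟨Tzero_mem_innerT, Tzero_mem_innerT⟩
  · simp [det_true_and_iff, not_det_Tzero]

theorem not_proves_axT11 : ¬ Proves CDplus axT11 := by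
  intro h
  have h := satS_detModel_of_proves disjoint_detSet_Tzero h
  simp only [axT11, sTF, tmF, Fml.SatS, Fml.satS_imp, Fml.satS_iff, Fml.satS_or, Term.evalS,
    v0, v1] at h
  have h : ∀ a b : ℕ, isSentTC a ∧ isSentTC b →
      (opFT (opTneg (opNum (opFand a b))) ∈ outerT {Tzero.code, Tzero.not.code} ↔
      opFT (opTneg (opNum a)) ∈ outerT {Tzero.code, Tzero.not.code} ∨
        opFT (opTneg (opNum b)) ∈ outerT {Tzero.code, Tzero.not.code}) := h
  specialize h Tzero.code Tzero.code ⟨isSentTC_Tzero, isSentTC_Tzero⟩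
  rw [TF_mem_outerT, TF_mem_outerT, opFand_code, opFneg_code, opFneg_code,
    mem_innerT_of_not_det] at h
  · simpa [Tzero] using h.2 (.inl Tzero_not_mem_innerT)
  · simp [det_not_iff, det_false_and_iff, not_det_Tzero]

theorem isFml1TC_Tzero (k : ℕ) : isFml1TC k Tzero.code :=
  ⟨_, rfl, isSentT_Tzero.1, isSentT_Tzero.2.1, by simp [isSentT_Tzero.2.2]⟩

theorem satS_axT12 (S : Struc) (σ : ℕ → S.M) :
    Fml.SatS S σ axT12 ↔ ∀ k a : S.M, S.fml1T k a →
      (S.T (S.fT (S.num (S.fall k a))) ↔ S.T (S.uall k a)) := by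
  simp [axT12, sTT, tmT, Fml.SatS, Fml.satS_imp, Fml.satS_iff, Term.evalS, v0, v1]

theorem satS_axT13 (S : Struc) (σ : ℕ → S.M) :
    Fml.SatS S σ axT13 ↔ ∀ k a : S.M, S.fml1T k a →
      (S.T (S.fT (S.tneg (S.num (S.fall k a)))) ↔ S.T (S.uex k a)) := by
  simp [axT13, sTF, tmF, Fml.SatS, Fml.satS_imp, Fml.satS_iff, Term.evalS, v0, v1]

theorem detModel_uall (Z : Set ℕ) (k n : ℕ) : (detModel Z).uall k n = opUall k n := by
  simp only [detModel, stdStruc]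

theorem detModel_uex (Z : Set ℕ) (k n : ℕ) : (detModel Z).uex k n = opUex k n := by
  simp only [detModel, stdStruc]

theorem not_proves_axT12 : ¬ Proves CDplus axT12 := by
  intro h
  have h := (satS_axT12 _ _).1 (satS_detModel_of_proves disjoint_detSet_Tzero h)
  have h : ∀ k a n : ℕ, (detModel {Tzero.code, Tzero.not.code}).uall k a = n → isFml1TC k a →
      (opFT (opNum (opFall k a)) ∈ outerT {Tzero.code, Tzero.not.code} ↔
      n ∈ outerT {Tzero.code, Tzero.not.code}) := by
    rintro k a _ rfl
    exact h k a
  specialize h 0 Tzero.code _ (detModel_uall ..) (isFml1TC_Tzero 0)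
  rw [TT_mem_outerT, opFall_code, opUall_mem_outerT, mem_innerT_of_not_det] at h
  · simpa [Tzero] using h.2 fun _ _ => Tzero_mem_innerT
  · simp [det_true_all_iff, not_det_Tzero]

theorem not_proves_axT13 : ¬ Proves CDplus axT13 := by
  intro h
  have h := (satS_axT13 _ _).1 (satS_detModel_of_proves disjoint_detSet_Tzero h)
  have h : ∀ k a n : ℕ, (detModel {Tzero.code, Tzero.not.code}).uex k a = n → isFml1TC k a →
      (opFT (opTneg (opNum (opFall k a))) ∈ outerT {Tzero.code, Tzero.not.code} ↔
      n ∈ outerT {Tzero.code, Tzero.not.code}) := by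
    rintro k a _ rfl
    exact h k a
  specialize h 0 Tzero.code _ (detModel_uex ..) (isFml1TC_Tzero 0)
  rw [TF_mem_outerT, opFall_code, opFneg_code, opUex_mem_outerT, mem_innerT_of_not_det] at h
  · simpa [Tzero] using h.2 ⟨.zero, rfl, Tzero_not_mem_innerT⟩
  · simp [det_not_iff, det_false_all_iff, not_det_Tzero]

/-- `CD⁺` proves none of:
(i) `∀t(TTTt → TTt)`; (ii) `∀t(TTt → TTTt)`;
(iii) `(∀φ ∈ Sent(L_T))(TTφ ↔ TT¬¬φ)`;
(iv) `(∀φ,ψ ∈ Sent(L_T))(TT(φ∧ψ) ↔ TTφ ∧ TTψ)`;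
(v) `(∀φ,ψ ∈ Sent(L_T))(TF(φ∧ψ) ↔ TFφ ∨ TFψ)`;
(vi) `(∀φ(v) ∈ Fml¹(L_T))(TT(∀vφ) ↔ T(∀t Tφ(t)))`;
(vii) `(∀φ(v) ∈ Fml¹(L_T))(TF(∀vφ) ↔ T(∃t Fφ(t)))`. -/
theorem cdplus_not_prove_inner_strong_kleene :
    (¬ Proves CDplus (Fml.all 0 ((Fml.ct v0).imp
        ((sTT (tmT v0)).imp (tTT v0))))) ∧
    (¬ Proves CDplus (Fml.all 0 ((Fml.ct v0).imp
        ((tTT v0).imp (sTT (tmT v0)))))) ∧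
    (¬ Proves CDplus axT9) ∧
    (¬ Proves CDplus axT10) ∧
    (¬ Proves CDplus axT11) ∧
    (¬ Proves CDplus axT12) ∧
    (¬ Proves CDplus axT13) :=
  ⟨not_proves_TTT_imp_TT, not_proves_TT_imp_TTT, not_proves_axT9, not_proves_axT10,
    not_proves_axT11, not_proves_axT12, not_proves_axT13⟩

end CDT
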